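/- (Weight-zero case of the key injectivity Lemma 4.1 / lem:char.) Assume O is henselian and admits a coefficient field K ⊆ O (e.g. O = K[[z]]). Let n ≥ 1 and r ≥ 2. If a = (a_0,…,a_{n−1}) ∈ Fil^p_r Wₙ(L) satisfies F^{n−1}(a) = a_0^{p^{n−1}} ∈ filW₁_{r−1} and F^{n−1}d(a) = Σ_{i=0}^{n−1} a_i^{p^{n−1−i}−1}·da_i ∈ FilΩ_{r−1}, then a ∈ Fil^p_{r−1} Wₙ(L) + p̲(Fil^p_r W_{n−1}(L)). Equivalently, the map F^{n−1} ⊕ F^{n−1}d is injective on the quotient Fil^p_r Wₙ(L) / (Fil^p_{r−1} Wₙ(L) + p̲(Fil^p_r W_{n−1}(L))). -/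

import Mathlib

noncomputable section

open scoped Classical

/-- A discretely valued field: a field `L` together with a normalized additive valuation
`v : L → ℤ ∪ {∞}` and a uniformizer `z` (so `v z = 1`).  The valuation ring is
`O = {a : L | 0 ≤ v a}`, with maximal ideal `𝔪 = {a : L | 1 ≤ v a}`. -/
structure DVField (L : Type) [Field L] : Type where
  v : L → WithTop ℤ
  z : L
  v_top : ∀ a : L, v a = ⊤ ↔ a = 0
  v_mul : ∀ a b : L, v (a * b) = v a + v b
  v_add : ∀ a b : L, min (v a) (v b) ≤ v (a + b)
  v_z : v z = 1

namespace DVField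

variable {L : Type} [Field L]

/-- `Wₙ(O) ⊆ Wₙ(L)`: the truncated Witt vectors all of whose components are integral. -/
def WO (D : DVField L) (p n : ℕ) : Set (TruncatedWittVector p n L) :=
  {x | ∀ i : Fin n, 0 ≤ D.v (x.coeff i)}

/-- The Brylinski–Kato filtration
`fil^log_r Wₙ(L) = {(a₀, …, a_{n-1}) | p^{n-1-i} · v(aᵢ) ≥ -r for all i}`. -/
def filLog (D : DVField L) (p r n : ℕ) : Set (TruncatedWittVector p n L) :=
  {x | ∀ i : Fin n, (↑(-(r : ℤ)) : WithTop ℤ) ≤ p ^ (n - 1 - (i : ℕ)) • D.v (x.coeff i)}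

end DVField

/-- The Verschiebung `V : Wₙ(L) → W_{n+1}(L)`, shifting components. -/
def wV {p : ℕ} {L : Type} [Field L] {n : ℕ} (x : TruncatedWittVector p n L) :
    TruncatedWittVector p (n + 1) L :=
  TruncatedWittVector.mk p fun i =>
    if h : (i : ℕ) = 0 then 0 else x.coeff ⟨(i : ℕ) - 1, by have := i.isLt; omega⟩

/-- The iterated Verschiebung `V^{n-m} : W_m(L) → Wₙ(L)` (for `m ≤ n`), given by shifting
components by `n - m`. -/
def wVit {p : ℕ} {L : Type} [Field L] {m n : ℕ} (x : TruncatedWittVector p m L) :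
    TruncatedWittVector p n L :=
  TruncatedWittVector.mk p fun i =>
    if h : n - m ≤ (i : ℕ) ∧ (i : ℕ) - (n - m) < m then x.coeff ⟨(i : ℕ) - (n - m), h.2⟩ else 0

/-- The restriction `R : W_{n+1}(L) → Wₙ(L)`, dropping the last component. -/
def wR {p : ℕ} {L : Type} [Field L] {n : ℕ} (x : TruncatedWittVector p (n + 1) L) :
    TruncatedWittVector p n L :=
  TruncatedWittVector.mk p fun i => x.coeff i.castSucc

/-- The iterated restriction `R^{m-n} : W_m(L) → Wₙ(L)` (for `n ≤ m`), keeping the first `n`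
components. -/
def wRes {p : ℕ} {L : Type} [Field L] {m n : ℕ} (x : TruncatedWittVector p m L) :
    TruncatedWittVector p n L :=
  TruncatedWittVector.mk p fun i => if h : (i : ℕ) < m then x.coeff ⟨(i : ℕ), h⟩ else 0

/-- The Frobenius `F : W_{n+1}(L) → Wₙ(L)` in characteristic `p`:
componentwise `p`-th power followed by restriction. -/
def wF {p : ℕ} {L : Type} [Field L] {n : ℕ} (x : TruncatedWittVector p (n + 1) L) :
    TruncatedWittVector p n L :=
  TruncatedWittVector.mk p fun i => x.coeff i.castSucc ^ p

/-- The Teichmüller lift `[a] = (a, 0, …, 0)`. -/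
def wT (p : ℕ) {L : Type} [Field L] (n : ℕ) (a : L) : TruncatedWittVector p n L :=
  TruncatedWittVector.mk p fun i => if (i : ℕ) = 0 then a else 0

/-- The map `p̲ : Wₙ(L) → W_{n+1}(L)`: lift to length `n+1` (by appending a zero component)
and multiply by `p`. -/
def wP {p : ℕ} [Fact p.Prime] {L : Type} [Field L] {n : ℕ} (x : TruncatedWittVector p n L) :
    TruncatedWittVector p (n + 1) L :=
  p • (wRes x : TruncatedWittVector p (n + 1) L)

namespace DVField

variable {L : Type} [Field L]

/-- The Kato–Matsuda filtration
`fil_r Wₙ(L) = fil^log_{r-1} Wₙ(L) + V^{n-m}(fil^log_r W_m(L))` where `m = min(v_p(r), n)`,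
and `fil_0 Wₙ(L) = Wₙ(O)`. -/
def filKM (D : DVField L) (p : ℕ) [Fact p.Prime] (r n : ℕ) :
    Set (TruncatedWittVector p n L) :=
  if r = 0 then D.WO p n
  else {x | ∃ a ∈ D.filLog p (r - 1) n,
    ∃ b ∈ D.filLog p r (min (padicValNat p r) n), x = a + wVit b}

/-- The `p`-saturation `Fil^p_r Wₙ(L) = Σ_{s=0}^{n-1} p^s · fil_{r·p^s} Wₙ(L)`. -/
def FilP (D : DVField L) (p : ℕ) [Fact p.Prime] (r n : ℕ) :
    Set (TruncatedWittVector p n L) :=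
  {x | ∃ f : Fin n → TruncatedWittVector p n L,
      (∀ s : Fin n, f s ∈ D.filKM p (r * p ^ (s : ℕ)) n) ∧
      x = ∑ s : Fin n, p ^ (s : ℕ) • f s}

end DVField

namespace DVField

variable {L : Type} [Field L]

/-- The valuation ring `O` is henselian: every monic polynomial with integral coefficients
having an integral approximate root at which the derivative is a unit has an integral
actual root refining it. -/
def IsHenselian (D : DVField L) : Prop :=
  ∀ f : Polynomial L, f.Monic → (∀ i : ℕ, 0 ≤ D.v (f.coeff i)) →
    ∀ a₀ : L, 0 ≤ D.v a₀ → 1 ≤ D.v (f.eval a₀) →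
      D.v ((Polynomial.derivative f).eval a₀) = 0 →
        ∃ a : L, 0 ≤ D.v a ∧ f.eval a = 0 ∧ 1 ≤ D.v (a - a₀)

/-- `K` is a coefficient field for the valuation ring `O`: a subfield of `L` contained in `O`
mapping isomorphically onto the residue field `κ = O/𝔪` (surjectivity onto `κ` suffices, since
a subfield of `O` automatically injects into `κ`). -/
def IsCoeffField (D : DVField L) (K : Subfield L) : Prop :=
  (∀ a ∈ K, 0 ≤ D.v a) ∧ (∀ a : L, 0 ≤ D.v a → ∃ μ ∈ K, 1 ≤ D.v (a - μ))

end DVField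

namespace DVField

variable {L : Type} [Field L]

/-- `Ω¹_O ⊆ Ω¹_L`: the image of the Kähler differentials of the valuation ring `O` in
`Ω¹_L = Ω[L⁄k]`, i.e. the additive subgroup generated by the elements `a • d b` with
`a, b ∈ O` (i.e. `v a ≥ 0` and `v b ≥ 0`). -/
def OmegaO (D : DVField L) (k : Type) [CommRing k] [Algebra k L] : AddSubgroup (Ω[L⁄k]) :=
  AddSubgroup.closure
    {ω | ∃ a b : L, 0 ≤ D.v a ∧ 0 ≤ D.v b ∧ ω = a • (KaehlerDifferential.D k L) b}

/-- `Ω¹_O(log) = Ω¹_O + O · dlog z ⊆ Ω¹_L`, where `dlog z = z⁻¹ • d z`. -/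
def OmegaOLog (D : DVField L) (k : Type) [CommRing k] [Algebra k L] : AddSubgroup (Ω[L⁄k]) :=
  AddSubgroup.closure
    ({ω | ∃ a b : L, 0 ≤ D.v a ∧ 0 ≤ D.v b ∧ ω = a • (KaehlerDifferential.D k L) b} ∪
      {ω | ∃ a : L, 0 ≤ D.v a ∧ ω = a • (D.z⁻¹ • (KaehlerDifferential.D k L) D.z)})

end DVField

/-- The map `F^{n-1}d : Wₙ(L) → Ω¹_L`, `(a₀, …, a_{n-1}) ↦ Σᵢ aᵢ^{p^{n-1-i}-1} • daᵢ`
(the component formula for the composite of the de Rham–Witt differential with the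
`(n-1)`-fold Frobenius). -/
def wFd (p : ℕ) (k : Type) [CommRing k] {L : Type} [Field L] [Algebra k L] {n : ℕ}
    (x : TruncatedWittVector p n L) : Ω[L⁄k] :=
  ∑ i : Fin n, x.coeff i ^ (p ^ (n - 1 - (i : ℕ)) - 1) • (KaehlerDifferential.D k L) (x.coeff i)

namespace DVField

variable {L : Type} [Field L]

/-- The explicit description of `Fil^p_s Ω¹_L = Fil^p_s W₁Ω¹_L`:
`𝔪^{-(s-1)} · Ω¹_O(log)` if `p ∤ s`, and `𝔪^{-s} · Ω¹_O` if `p ∣ s`. -/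
def FilOmega (D : DVField L) (k : Type) [CommRing k] [Algebra k L] (p s : ℕ) :
    Set (Ω[L⁄k]) :=
  if p ∣ s then {ω | ∃ η ∈ D.OmegaO k, ω = (D.z ^ s)⁻¹ • η}
  else {ω | ∃ η ∈ D.OmegaOLog k, ω = (D.z ^ (s - 1))⁻¹ • η}

/-- The explicit description of `Fil^p_s W₁(L)`:
`𝔪^{-(s-1)}` if `p ∤ s`, and `𝔪^{-s}` if `p ∣ s`. -/
def filWOne (D : DVField L) (p s : ℕ) : Set L :=
  if p ∣ s then {a : L | (↑(-(s : ℤ)) : WithTop ℤ) ≤ D.v a}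
  else {a : L | (↑(-((s : ℤ) - 1)) : WithTop ℤ) ≤ D.v a}

end DVField

section WittGeneral

open WittVector

/-- Twisting a Witt vector by powers of `t`. -/
def wTwist (p : ℕ) {R : Type*} [CommRing R] (t : R) (x : WittVector p R) : WittVector p R :=
  WittVector.mk p fun k => t ^ p ^ k * x.coeff k

theorem wTwist_coeff {p : ℕ} {R : Type*} [CommRing R] (t : R) (x : WittVector p R) (k : ℕ) :
    (wTwist p t x).coeff k = t ^ p ^ k * x.coeff k := by
  simp [wTwist]

theorem map_wTwist {p : ℕ} [Fact p.Prime] {R S : Type*} [CommRing R] [CommRing S] (f : R →+* S)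
    (t : R) (x : WittVector p R) :
    WittVector.map f (wTwist p t x) = wTwist p (f t) (WittVector.map f x) := by
  ext k
  simp [wTwist_coeff, WittVector.map_coeff]

theorem ghost_wTwist {p : ℕ} [Fact p.Prime] {R : Type*} [CommRing R]
    (t : R) (x : WittVector p R) (n : ℕ) :
    ghostComponent n (wTwist p t x) = t ^ p ^ n * ghostComponent n x := by
  rw [ghostComponent_apply, ghostComponent_apply, aeval_wittPolynomial, aeval_wittPolynomial,
    Finset.mul_sum]
  refine Finset.sum_congr rfl fun i hi => ?_
  have hi' : i ≤ n := Nat.lt_succ_iff.mp (Finset.mem_range.mp hi)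
  rw [wTwist_coeff, mul_pow, ← pow_mul, ← pow_add, Nat.add_sub_cancel' hi']
  ring

theorem wTwist_sub_aux1 {p : ℕ} [Fact p.Prime] {R : Type*} (t : MvPolynomial R ℚ)
    (x y : WittVector p (MvPolynomial R ℚ)) :
    wTwist p t (x - y) = wTwist p t x - wTwist p t y := by
  apply (ghostMap.bijective_of_invertible p (MvPolynomial R ℚ)).1
  rw [map_sub]
  ext1 n
  simp only [Pi.sub_apply, ghostMap_apply, ghost_wTwist, map_sub, mul_sub]

theorem wTwist_sub_aux2 {p : ℕ} [Fact p.Prime] {R : Type*} (t : MvPolynomial R ℤ)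
    (x y : WittVector p (MvPolynomial R ℤ)) :
    wTwist p t (x - y) = wTwist p t x - wTwist p t y := by
  refine map_injective (MvPolynomial.map (Int.castRingHom ℚ))
    (MvPolynomial.map_injective _ Int.cast_injective) ?_
  simp only [map_wTwist, map_sub, wTwist_sub_aux1]

theorem wTwist_sub {p : ℕ} [Fact p.Prime] {R : Type*} [CommRing R] (t : R)
    (x y : WittVector p R) :
    wTwist p t (x - y) = wTwist p t x - wTwist p t y := by
  obtain ⟨t, rfl⟩ := MvPolynomial.counit_surjective R t
  obtain ⟨x, rfl⟩ := map_surjective _ (MvPolynomial.counit_surjective R) x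
  obtain ⟨y, rfl⟩ := map_surjective _ (MvPolynomial.counit_surjective R) y
  simp only [← map_wTwist, ← map_sub, wTwist_sub_aux2]

theorem witt_sub_mem_subring {p : ℕ} [Fact p.Prime] {S : Type*} [CommRing S] (H : Subring S)
    (x y : WittVector p S) (hx : ∀ k, x.coeff k ∈ H) (hy : ∀ k, y.coeff k ∈ H) (k : ℕ) :
    (x - y).coeff k ∈ H := by
  have h1 : x = WittVector.map H.subtype (WittVector.mk p fun k => ⟨x.coeff k, hx k⟩) := by
    ext k; simp [WittVector.map_coeff]
  have h2 : y = WittVector.map H.subtype (WittVector.mk p fun k => ⟨y.coeff k, hy k⟩) := by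
    ext k; simp [WittVector.map_coeff]
  rw [h1, h2, ← map_sub, WittVector.map_coeff]
  exact Subtype.property _

/-- The map `F^n d` on (infinite) Witt vectors. -/
def wFdInf (p n : ℕ) {A : Type*} [CommRing A] (x : WittVector p A) : Ω[A⁄ℤ] :=
  ∑ i ∈ Finset.range (n + 1), x.coeff i ^ (p ^ (n - i) - 1) • KaehlerDifferential.D ℤ A (x.coeff i)

theorem D_ghost {p : ℕ} [Fact p.Prime] (n : ℕ) {A : Type*} [CommRing A] (x : WittVector p A) :
    KaehlerDifferential.D ℤ A (ghostComponent n x) = (p ^ n : ℕ) • wFdInf p n x := by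
  rw [ghostComponent_apply, aeval_wittPolynomial, map_sum, wFdInf, Finset.smul_sum]
  refine Finset.sum_congr rfl fun i hi => ?_
  have hi' : i ≤ n := Nat.lt_succ_iff.mp (Finset.mem_range.mp hi)
  have h1 : ((p : A) ^ i * x.coeff i ^ p ^ (n - i)) = (p ^ i : ℕ) • (x.coeff i ^ p ^ (n - i)) := by
    rw [nsmul_eq_mul]; push_cast; rfl
  rw [h1, map_nsmul, Derivation.leibniz_pow, ← mul_nsmul, ← pow_add,
    add_comm, Nat.add_sub_cancel' hi']

theorem omega_mvPoly_torsionFree {R : Type*} (inst : Algebra ℤ (MvPolynomial R ℤ)) (k : ℕ)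
    (x y : Ω[MvPolynomial R ℤ⁄ℤ]) (hk : k ≠ 0) (h : k • x = k • y) : x = y := by
  obtain rfl : inst = AddMonoidAlgebra.algebra := Subsingleton.elim _ _
  rw [← Nat.cast_smul_eq_nsmul (MvPolynomial R ℤ), ← Nat.cast_smul_eq_nsmul (MvPolynomial R ℤ)] at h
  have h2 := congrArg (KaehlerDifferential.mvPolynomialBasis ℤ R).repr h
  rw [map_smul, map_smul] at h2
  apply (KaehlerDifferential.mvPolynomialBasis ℤ R).repr.injective
  ext1 j
  have h3 := DFunLike.congr_fun h2 j
  rw [Finsupp.smul_apply, Finsupp.smul_apply, smul_eq_mul, smul_eq_mul] at h3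
  exact mul_left_cancel₀ (Nat.cast_ne_zero.mpr hk) h3

theorem wFdInf_add_aux {p : ℕ} [Fact p.Prime] (n : ℕ) {R : Type*}
    (x y : WittVector p (MvPolynomial R ℤ)) :
    wFdInf p n (x + y) = wFdInf p n x + wFdInf p n y := by
  have h : (p ^ n : ℕ) • wFdInf p n (x + y) = (p ^ n : ℕ) • (wFdInf p n x + wFdInf p n y) := by
    rw [smul_add, ← D_ghost, ← D_ghost, ← D_ghost, map_add, map_add]
  have hp : (p ^ n : ℕ) ≠ 0 := pow_ne_zero _ (Fact.out : p.Prime).ne_zero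
  exact omega_mvPoly_torsionFree _ _ _ _ hp h

theorem wFdInf_map {p : ℕ} [Fact p.Prime] (n : ℕ) {A B : Type*} [CommRing A] [CommRing B]
    [Algebra A B] (x : WittVector p A) :
    wFdInf p n (WittVector.map (algebraMap A B) x) =
      KaehlerDifferential.map ℤ ℤ A B (wFdInf p n x) := by
  simp only [wFdInf, map_sum, WittVector.map_coeff]
  refine Finset.sum_congr rfl fun i _ => ?_
  rw [map_smul, KaehlerDifferential.map_D, ← map_pow, algebraMap_smul]

theorem wFdInf_add {p : ℕ} [Fact p.Prime] (n : ℕ) {A : Type*} [CommRing A]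
    (x y : WittVector p A) :
    wFdInf p n (x + y) = wFdInf p n x + wFdInf p n y := by
  let _ : Algebra (MvPolynomial A ℤ) A := (MvPolynomial.counit A).toAlgebra
  have hs : Function.Surjective (algebraMap (MvPolynomial A ℤ) A) := MvPolynomial.counit_surjective A
  obtain ⟨x, rfl⟩ := map_surjective _ hs x
  obtain ⟨y, rfl⟩ := map_surjective _ hs y
  rw [← map_add, wFdInf_map, wFdInf_map, wFdInf_map, wFdInf_add_aux, map_add]

theorem wFdInf_p_mul {p : ℕ} [Fact p.Prime] (n : ℕ) {A : Type*} [CommRing A] [CharP A p]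
    (x : WittVector p A) : wFdInf p n (x * (p : WittVector p A)) = 0 := by
  rw [wFdInf]
  refine Finset.sum_eq_zero fun i _ => ?_
  cases i with
  | zero => simp [mul_charP_coeff_zero]
  | succ i =>
    rw [mul_charP_coeff_succ, Derivation.leibniz_pow]
    have : (p : ℕ) • (x.coeff i ^ (p - 1) • KaehlerDifferential.D ℤ A (x.coeff i)) = 0 := by
      rw [← Nat.cast_smul_eq_nsmul A, CharP.cast_eq_zero, zero_smul]
    rw [this, smul_zero]

theorem wFd_truncate {p : ℕ} [Fact p.Prime] (n : ℕ) {L : Type} [Field L] (x : WittVector p L) :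
    wFd p ℤ (WittVector.truncate (n + 1) x) = wFdInf p n x := by
  rw [wFd, wFdInf, Finset.sum_range]
  refine Finset.sum_congr rfl fun i _ => ?_
  rw [WittVector.coeff_truncate]
  rfl

theorem wFd_add {p : ℕ} [Fact p.Prime] {n : ℕ} {L : Type} [Field L]
    (x y : TruncatedWittVector p (n + 1) L) : wFd p ℤ (x + y) = wFd p ℤ x + wFd p ℤ y := by
  obtain ⟨x, rfl⟩ := WittVector.truncate_surjective p (n + 1) L x
  obtain ⟨y, rfl⟩ := WittVector.truncate_surjective p (n + 1) L y
  rw [← map_add, wFd_truncate, wFd_truncate, wFd_truncate, wFdInf_add]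

theorem wRes_eq_truncate {p : ℕ} [Fact p.Prime] {m : ℕ} {L : Type} [Field L]
    (x : TruncatedWittVector p m L) :
    (wRes x : TruncatedWittVector p (m + 1) L) = WittVector.truncate (m + 1) x.out := by
  ext i
  rw [WittVector.coeff_truncate]
  simp [wRes, TruncatedWittVector.out]

theorem nsmul_truncate {p : ℕ} [Fact p.Prime] {n k : ℕ} {L : Type} [Field L]
    (x : WittVector p L) :
    k • WittVector.truncate n x = WittVector.truncate n (x * (k : WittVector p L)) := by
  rw [nsmul_eq_mul, map_mul, map_natCast, mul_comm]

theorem wP_eq {p : ℕ} [Fact p.Prime] {m : ℕ} {L : Type} [Field L]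
    (x : TruncatedWittVector p m L) : wP x = WittVector.truncate (m + 1) (x.out * (p : WittVector p L)) := by
  rw [wP, wRes_eq_truncate, nsmul_truncate]

theorem wFd_wP {p : ℕ} [Fact p.Prime] {m : ℕ} {L : Type} [Field L] [CharP L p]
    (x : TruncatedWittVector p m L) : wFd p ℤ (wP x) = 0 := by
  rw [wP_eq, wFd_truncate, wFdInf_p_mul]

theorem wP_coeff_zero {p : ℕ} [Fact p.Prime] {m : ℕ} {L : Type} [Field L] [CharP L p]
    (x : TruncatedWittVector p m L) : (wP x).coeff 0 = 0 := by
  rw [wP_eq, WittVector.coeff_truncate]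
  exact mul_charP_coeff_zero _

theorem wP_coeff_succ {p : ℕ} [Fact p.Prime] {m : ℕ} {L : Type} [Field L] [CharP L p]
    (x : TruncatedWittVector p m L) (i : Fin m) : (wP x).coeff i.succ = x.coeff i ^ p := by
  rw [wP_eq, WittVector.coeff_truncate, Fin.val_succ, mul_charP_coeff_succ,
    TruncatedWittVector.coeff_out]

theorem wR_eq {p : ℕ} [Fact p.Prime] {m : ℕ} {L : Type} [Field L]
    (x : TruncatedWittVector p (m + 1) L) :
    wR x = TruncatedWittVector.truncate (Nat.le_succ m) x := by
  ext i
  simp [wR, TruncatedWittVector.coeff_truncate]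
  rfl

/-- `p • x` only depends on the restriction of `x`. -/
theorem p_nsmul_eq_wP_wR {p : ℕ} [Fact p.Prime] {m : ℕ} {L : Type} [Field L] [CharP L p]
    (x : TruncatedWittVector p (m + 1) L) : p • x = wP (wR x) := by
  obtain ⟨x, rfl⟩ := WittVector.truncate_surjective p (m + 1) L x
  rw [nsmul_truncate]
  ext i
  refine Fin.cases ?_ (fun i => ?_) i
  · rw [wP_coeff_zero, WittVector.coeff_truncate]
    exact mul_charP_coeff_zero _
  · rw [wP_coeff_succ, WittVector.coeff_truncate, Fin.val_succ, mul_charP_coeff_succ]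
    simp [wR, WittVector.coeff_truncate]

theorem wR_surj {p : ℕ} [Fact p.Prime] {m : ℕ} {L : Type} [Field L]
    (x : TruncatedWittVector p m L) : ∃ y : TruncatedWittVector p (m + 1) L, wR y = x := by
  obtain ⟨y, hy⟩ := TruncatedWittVector.truncate_surjective (p := p) (R := L) (Nat.le_succ m) x
  exact ⟨y, by rw [wR_eq, hy]⟩

theorem wR_add {p : ℕ} [Fact p.Prime] {m : ℕ} {L : Type} [Field L]
    (x y : TruncatedWittVector p (m + 1) L) : wR (x + y) = wR x + wR y := by
  simp only [wR_eq, map_add]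

theorem wP_add {p : ℕ} [Fact p.Prime] {m : ℕ} {L : Type} [Field L] [CharP L p]
    (x y : TruncatedWittVector p m L) : wP (x + y) = wP x + wP y := by
  obtain ⟨x, rfl⟩ := wR_surj x
  obtain ⟨y, rfl⟩ := wR_surj y
  rw [← wR_add, ← p_nsmul_eq_wP_wR, ← p_nsmul_eq_wP_wR, ← p_nsmul_eq_wP_wR, smul_add]

end WittGeneral

namespace DVField

section Val

variable {L : Type} [Field L] (D : DVField L)

/-- `D.Ge N a` says that the valuation of `a` is at least `N`. -/
def Ge (N : ℤ) (a : L) : Prop := (N : WithTop ℤ) ≤ D.v a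

theorem v_zero : D.v 0 = ⊤ := (D.v_top 0).mpr rfl

theorem v_ne_top {a : L} (ha : a ≠ 0) : ∃ k : ℤ, D.v a = k := by
  have h : D.v a ≠ ⊤ := fun h => ha ((D.v_top a).mp h)
  obtain ⟨k, hk⟩ := WithTop.ne_top_iff_exists.mp h
  exact ⟨k, hk.symm⟩

theorem v_one : D.v 1 = 0 := by
  obtain ⟨k, hk⟩ := D.v_ne_top (one_ne_zero (α := L))
  have h := D.v_mul 1 1
  rw [mul_one, hk] at h
  rw [hk]
  norm_cast at h ⊢
  omega

theorem v_neg (a : L) : D.v (-a) = D.v a := by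
  have h1 : D.v (-1) = 0 := by
    obtain ⟨k, hk⟩ := D.v_ne_top (neg_ne_zero.mpr (one_ne_zero (α := L)))
    have h := D.v_mul (-1) (-1)
    rw [neg_one_mul, neg_neg, v_one, hk] at h
    rw [hk]
    norm_cast at h ⊢
    omega
  rw [← neg_one_mul, D.v_mul, h1, zero_add]

theorem z_ne_zero : D.z ≠ 0 := by
  intro h
  have h1 := D.v_z
  rw [h, v_zero] at h1
  exact absurd h1 (by decide)

theorem v_zpow (N : ℤ) : D.v (D.z ^ N) = N := by
  induction N using Int.induction_on with
  | zero => simp [v_one]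
  | succ n ih => rw [zpow_add_one₀ D.z_ne_zero, D.v_mul, ih, D.v_z]; norm_cast
  | pred n ih =>
    have h : D.z ^ (-(n : ℤ)) = D.z ^ (-(n : ℤ) - 1) * D.z := by
      rw [← zpow_add_one₀ D.z_ne_zero]; congr 1; omega
    rw [h, D.v_mul, D.v_z] at ih
    obtain ⟨k, hk⟩ := D.v_ne_top (zpow_ne_zero (-(n : ℤ) - 1) D.z_ne_zero)
    rw [hk] at ih ⊢
    norm_cast at ih ⊢
    omega

variable {D}

theorem Ge.zero (N : ℤ) : D.Ge N 0 := by simp [Ge, v_zero]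

theorem Ge.mono {N M : ℤ} {a : L} (h : D.Ge N a) (hM : M ≤ N) : D.Ge M a :=
  le_trans (WithTop.coe_le_coe.mpr hM) h

theorem Ge.neg {N : ℤ} {a : L} (h : D.Ge N a) : D.Ge N (-a) := by
  rw [Ge, v_neg]; exact h

theorem Ge.add {N : ℤ} {a b : L} (h : D.Ge N a) (h' : D.Ge N b) : D.Ge N (a + b) :=
  le_trans (le_min h h') (D.v_add a b)

theorem Ge.sub {N : ℤ} {a b : L} (h : D.Ge N a) (h' : D.Ge N b) : D.Ge N (a - b) := by
  rw [sub_eq_add_neg]; exact h.add h'.neg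

theorem Ge.sum {N : ℤ} {ι : Type*} (s : Finset ι) (f : ι → L) (h : ∀ i ∈ s, D.Ge N (f i)) :
    D.Ge N (∑ i ∈ s, f i) := by
  induction s using Finset.induction_on with
  | empty => simpa using Ge.zero N
  | insert a s ha ih =>
    rw [Finset.sum_insert ha]
    exact (h a (Finset.mem_insert_self a s)).add
      (ih fun i hi => h i (Finset.mem_insert_of_mem hi))

theorem Ge.mul {N M : ℤ} {a b : L} (h : D.Ge N a) (h' : D.Ge M b) : D.Ge (N + M) (a * b) := by
  rw [Ge, D.v_mul, WithTop.coe_add]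
  exact add_le_add h h'

theorem Ge.one : D.Ge 0 1 := by simp [Ge, v_one]

theorem Ge.zpow (N : ℤ) : D.Ge N (D.z ^ N) := by simp [Ge, v_zpow]

theorem Ge.zpow_mul {N M : ℤ} {a : L} (h : D.Ge M a) : D.Ge (N + M) (D.z ^ N * a) :=
  (Ge.zpow N).mul h

theorem Ge.pow {N : ℤ} {a : L} (h : D.Ge N a) (k : ℕ) : D.Ge (k * N) (a ^ k) := by
  induction k with
  | zero => simpa using Ge.one
  | succ k ih => rw [pow_succ]; exact (ih.mul h).mono (by push_cast; linarith)

theorem Ge.exists_unit {N : ℤ} {a : L} (h : D.Ge N a) : ∃ u, D.Ge 0 u ∧ a = D.z ^ N * u := by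
  refine ⟨D.z ^ (-N) * a, (h.zpow_mul).mono (by omega), ?_⟩
  rw [← mul_assoc, ← zpow_add₀ D.z_ne_zero]; simp

theorem Ge.div_zpow {N M : ℤ} {a : L} (h : D.Ge (N + M) (D.z ^ N * a)) : D.Ge M a := by
  have h' := Ge.zpow_mul (N := -N) h
  rw [← mul_assoc, ← zpow_add₀ D.z_ne_zero] at h'
  simpa using h'

theorem Ge.of_pow {N : ℤ} {a : L} {k : ℕ} (hk : k ≠ 0) (h : D.Ge N (a ^ k)) {M : ℤ}
    (hM : ((M : ℤ) - 1) * k < N) : D.Ge M a := by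
  by_cases ha : a = 0
  · subst ha; exact Ge.zero _
  obtain ⟨j, hj⟩ := D.v_ne_top ha
  have hv : ∀ k : ℕ, D.v (a ^ k) = ((k * j : ℤ) : WithTop ℤ) := by
    intro k
    induction k with
    | zero => simp [v_one]
    | succ k ih => rw [pow_succ, D.v_mul, ih, hj, ← WithTop.coe_add]; congr 1; push_cast; ring
  rw [Ge, hv, WithTop.coe_le_coe] at h
  rw [Ge, hj, WithTop.coe_le_coe]
  have hk' : (0 : ℤ) < k := by exact_mod_cast Nat.pos_of_ne_zero hk
  by_contra hlt
  push Not at hlt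
  have : (k : ℤ) * j ≤ k * (M - 1) := mul_le_mul_of_nonneg_left (by omega) hk'.le
  linarith

theorem filLog_cond_iff {r e : ℕ} (he : 0 < e) {a : L} :
    ((↑(-(r : ℤ)) : WithTop ℤ) ≤ e • D.v a) ↔ D.Ge (-((r / e : ℕ) : ℤ)) a := by
  by_cases ha : a = 0
  · subst ha
    refine iff_of_true ?_ (Ge.zero _)
    rw [v_zero]
    obtain ⟨e', rfl⟩ := Nat.exists_eq_succ_of_ne_zero he.ne'
    rw [succ_nsmul, WithTop.add_top]
    exact le_top
  obtain ⟨j, hj⟩ := D.v_ne_top ha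
  rw [Ge, hj, WithTop.coe_le_coe]
  have : (e • (j : WithTop ℤ)) = ((e * j : ℤ) : WithTop ℤ) := by
    rw [← WithTop.coe_nsmul, nsmul_eq_mul]
  rw [this, WithTop.coe_le_coe]
  have he' : (0 : ℤ) < e := by exact_mod_cast he
  push_cast
  have h2 : -j ≤ (r : ℤ) / e ↔ -j * e ≤ r := Int.le_ediv_iff_mul_le he'
  constructor
  · intro h; have := h2.mpr (by linarith); linarith
  · intro h; have := h2.mp (by linarith); linarith

theorem mem_filLog_iff {p : ℕ} [hp : Fact p.Prime] {r n : ℕ} {x : TruncatedWittVector p n L} :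
    x ∈ D.filLog p r n ↔
      ∀ i : Fin n, D.Ge (-((r / p ^ (n - 1 - (i : ℕ)) : ℕ) : ℤ)) (x.coeff i) := by
  simp only [filLog, Set.mem_ofPred_eq]
  exact forall_congr' fun i => filLog_cond_iff (pow_pos hp.out.pos _)

end Val

section Closure

open Polynomial

variable {L : Type} [Field L] (D : DVField L)

/-- The subring of pairs of polynomials with controlled coefficients. -/
def pairRing (α β : ℕ → ℤ) (hα0 : 0 ≤ α 0) (hα : ∀ N M, α N + α M ≤ α (N + M))
    (hβ : ∀ N M, β N + α M ≤ β (N + M)) : Subring (L[X] × L[X]) where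
  carrier := {f | (∀ N, D.Ge (-α N) (f.1.coeff N)) ∧ (∀ N, D.Ge (-α N) (f.2.coeff N)) ∧
    ∀ N, D.Ge (-β N) ((f.1 - f.2).coeff N)}
  mul_mem' := by
    rintro ⟨f, g⟩ ⟨f', g'⟩ ⟨h1, h2, h3⟩ ⟨h1', h2', h3'⟩
    simp only at h1 h2 h3 h1' h2' h3'
    have key : ∀ (a b : L[X]) (γ δ ε : ℕ → ℤ), (∀ N, D.Ge (-γ N) (a.coeff N)) →
        (∀ N, D.Ge (-δ N) (b.coeff N)) → (∀ N M, γ N + δ M ≤ ε (N + M)) →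
        ∀ N, D.Ge (-ε N) ((a * b).coeff N) := by
      intro a b γ δ ε ha hb hle N
      rw [coeff_mul]
      refine Ge.sum _ _ fun ij hij => ?_
      rw [Finset.HasAntidiagonal.mem_antidiagonal] at hij
      refine ((ha ij.1).mul (hb ij.2)).mono ?_
      have := hle ij.1 ij.2
      rw [hij] at this
      omega
    refine ⟨key f f' α α α h1 h1' hα, key g g' α α α h2 h2' hα, fun N => ?_⟩
    have e : (((f, g) * (f', g') : L[X] × L[X]).1 - ((f, g) * (f', g') : L[X] × L[X]).2) =
        (f - g) * f' + (f' - g') * g := by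
      simp only [Prod.mk_mul_mk]; ring
    rw [e, coeff_add]
    exact (key _ _ β α β h3 h1' hβ N).add (key _ _ β α β h3' h2 hβ N)
  one_mem' := by
    have key : ∀ N, D.Ge (-α N) ((1 : L[X]).coeff N) := by
      intro N
      rw [coeff_one]
      split_ifs with h
      · subst h; exact Ge.one.mono (by omega)
      · exact Ge.zero _
    refine ⟨key, key, fun N => ?_⟩
    simpa using Ge.zero _
  add_mem' := by
    rintro ⟨f, g⟩ ⟨f', g'⟩ ⟨h1, h2, h3⟩ ⟨h1', h2', h3'⟩
    simp only at h1 h2 h3 h1' h2' h3'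
    refine ⟨fun N => ?_, fun N => ?_, fun N => ?_⟩
    · simpa using (h1 N).add (h1' N)
    · simpa using (h2 N).add (h2' N)
    · have e : (((f, g) + (f', g') : L[X] × L[X]).1 - ((f, g) + (f', g') : L[X] × L[X]).2) =
        (f - g) + (f' - g') := by
        simp only [Prod.mk_add_mk]; ring
      rw [e, coeff_add]
      exact (h3 N).add (h3' N)
  zero_mem' := by
    refine ⟨fun N => ?_, fun N => ?_, fun N => ?_⟩ <;> simpa using Ge.zero _
  neg_mem' := by
    rintro ⟨f, g⟩ ⟨h1, h2, h3⟩
    simp only at h1 h2 h3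
    refine ⟨fun N => ?_, fun N => ?_, fun N => ?_⟩
    · simpa using (h1 N).neg
    · simpa using (h2 N).neg
    · have e : ((-(f, g) : L[X] × L[X]).1 - (-(f, g) : L[X] × L[X]).2) = -(f - g) := by
        simp only [Prod.neg_mk]; ring
      rw [e, coeff_neg]
      exact (h3 N).neg

variable {D}

theorem witt_gain {p : ℕ} [Fact p.Prime] (α β : ℕ → ℤ) (hα0 : 0 ≤ α 0)
    (hα : ∀ N M, α N + α M ≤ α (N + M))
    (hβ : ∀ N M, β N + α M ≤ β (N + M)) (x y : WittVector p L)
    (hx : ∀ k, D.Ge (-α (p ^ k)) (x.coeff k)) (hy : ∀ k, D.Ge (-α (p ^ k)) (y.coeff k))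
    (hxy : ∀ k, D.Ge (-β (p ^ k)) (x.coeff k - y.coeff k)) (i : ℕ) :
    D.Ge (-β (p ^ i)) ((x - y).coeff i) := by
  let x' : WittVector p L[X] := WittVector.map C x
  let y' : WittVector p L[X] := WittVector.map C y
  let U : WittVector p (L[X] × L[X]) := WittVector.mk p fun k =>
    (X ^ p ^ k * C (x.coeff k), X ^ p ^ k * C (y.coeff k))
  let V : WittVector p (L[X] × L[X]) := WittVector.mk p fun k =>
    (X ^ p ^ k * C (y.coeff k), X ^ p ^ k * C (y.coeff k))
  have hc : ∀ (k : ℕ) (a : L) (γ : ℕ → ℤ), D.Ge (-γ (p ^ k)) a →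
      ∀ N, D.Ge (-γ N) ((X ^ p ^ k * C a : L[X]).coeff N) := by
    intro k a γ h N
    rw [coeff_X_pow_mul', coeff_C]
    split_ifs with h1 h2
    · have : N = p ^ k := by omega
      rw [this]; exact h
    · exact Ge.zero _
    · exact Ge.zero _
  have hU : ∀ k, U.coeff k ∈ D.pairRing α β hα0 hα hβ := by
    intro k
    refine ⟨hc k _ α (hx k), hc k _ α (hy k), ?_⟩
    have e : (U.coeff k).1 - (U.coeff k).2 = X ^ p ^ k * C (x.coeff k - y.coeff k) := by
      simp [U, mul_sub]
    rw [e]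
    exact hc k _ β (hxy k)
  have hV : ∀ k, V.coeff k ∈ D.pairRing α β hα0 hα hβ := by
    intro k
    refine ⟨hc k _ α (hy k), hc k _ α (hy k), fun N => ?_⟩
    have e : (V.coeff k).1 - (V.coeff k).2 = 0 := by
      simp [V]
    rw [e]
    simpa using Ge.zero _
  have hUV := (witt_sub_mem_subring _ U V hU hV i).2.2 (p ^ i)
  have e1 : ((U - V).coeff i).1 = X ^ p ^ i * C ((x - y).coeff i) := by
    have h : WittVector.map (RingHom.fst L[X] L[X]) (U - V) = wTwist p X (x' - y') := by
      rw [map_sub, wTwist_sub]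
      congr 1
    have h2 := congrArg (fun w => WittVector.coeff w i) h
    simp only [WittVector.map_coeff, wTwist_coeff, x', y', ← map_sub] at h2
    exact h2
  have e2 : ((U - V).coeff i).2 = 0 := by
    have h : WittVector.map (RingHom.snd L[X] L[X]) (U - V) = 0 := by
      rw [map_sub, sub_eq_zero]
      ext1 k; simp [U, V, WittVector.map_coeff]
    have h2 := congrArg (fun w => WittVector.coeff w i) h
    simp only [WittVector.map_coeff] at h2
    simpa using h2
  rw [e1, e2, sub_zero, coeff_X_pow_mul', if_pos le_rfl, Nat.sub_self, coeff_C_zero] at hUV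
  exact hUV

theorem floor_superadd (A R : ℕ) (hA : 0 < A) (c : ℤ) (N M : ℕ) :
    ((R : ℤ) * N - c) / A + ((R : ℤ) * M) / A ≤ ((R : ℤ) * ((N + M : ℕ) : ℤ) - c) / A := by
  have hA' : (0 : ℤ) < A := by exact_mod_cast hA
  rw [Int.le_ediv_iff_mul_le hA', add_mul]
  have h1 := Int.ediv_mul_le ((R : ℤ) * N - c) hA'.ne'
  have h2 := Int.ediv_mul_le ((R : ℤ) * M) hA'.ne'
  push_cast
  linarith

theorem witt_gain' {p : ℕ} [Fact p.Prime] (A R : ℕ) (hA : 0 < A) (x y : WittVector p L)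
    (hx : ∀ k, D.Ge (-(((R : ℤ) * (p ^ k : ℕ)) / A)) (x.coeff k))
    (hy : ∀ k, D.Ge (-(((R : ℤ) * (p ^ k : ℕ)) / A)) (y.coeff k))
    (hxy : ∀ k, D.Ge (-(((R : ℤ) * (p ^ k : ℕ) - 1) / A)) (x.coeff k - y.coeff k)) (i : ℕ) :
    D.Ge (-(((R : ℤ) * (p ^ i : ℕ) - 1) / A)) ((x - y).coeff i) :=
  witt_gain (fun N => ((R : ℤ) * N) / A) (fun N => ((R : ℤ) * N - 1) / A) (by simp)
    (fun N M => by simpa using floor_superadd A R hA 0 N M)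
    (fun N M => floor_superadd A R hA 1 N M) x y hx hy hxy i

theorem witt_sub' {p : ℕ} [Fact p.Prime] (A R : ℕ) (hA : 0 < A) (x y : WittVector p L)
    (hx : ∀ k, D.Ge (-(((R : ℤ) * (p ^ k : ℕ)) / A)) (x.coeff k))
    (hy : ∀ k, D.Ge (-(((R : ℤ) * (p ^ k : ℕ)) / A)) (y.coeff k)) (i : ℕ) :
    D.Ge (-(((R : ℤ) * (p ^ i : ℕ)) / A)) ((x - y).coeff i) :=
  witt_gain (fun N => ((R : ℤ) * N) / A) (fun N => ((R : ℤ) * N) / A) (by simp)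
    (fun N M => by simpa using floor_superadd A R hA 0 N M)
    (fun N M => by simpa using floor_superadd A R hA 0 N M) x y hx hy
    (fun k => (hx k).sub (hy k)) i

theorem witt_add' {p : ℕ} [Fact p.Prime] (A R : ℕ) (hA : 0 < A) (x y : WittVector p L)
    (hx : ∀ k, D.Ge (-(((R : ℤ) * (p ^ k : ℕ)) / A)) (x.coeff k))
    (hy : ∀ k, D.Ge (-(((R : ℤ) * (p ^ k : ℕ)) / A)) (y.coeff k)) (i : ℕ) :
    D.Ge (-(((R : ℤ) * (p ^ i : ℕ)) / A)) ((x + y).coeff i) := by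
  have e : x + y = x - (0 - y) := by ring
  rw [e]
  refine witt_sub' A R hA x _ hx (fun k => ?_) i
  exact witt_sub' A R hA 0 y (fun k => by simpa using Ge.zero _) hy k

end Closure

end DVField

namespace DVField

section KM

variable {L : Type} [Field L] {D : DVField L} {p : ℕ} [hp : Fact p.Prime]

theorem trunc_out_coeff {n : ℕ} (x : TruncatedWittVector p n L) (i : Fin n) :
    TruncatedWittVector.truncate (p := p) (R := L) (show (i : ℕ) + 1 ≤ n from i.isLt) x =
      WittVector.truncate ((i : ℕ) + 1)
        (WittVector.mk p fun k => if h : k ≤ (i : ℕ) then x.coeff ⟨k, by omega⟩ else 0) := by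
  ext k
  rw [TruncatedWittVector.coeff_truncate, WittVector.coeff_truncate, WittVector.coeff_mk,
    dif_pos (by have := k.isLt; omega)]
  rfl

theorem div_cast {n R k : ℕ} (hk : k < n) :
    ((R : ℤ) * (p ^ k : ℕ)) / (p ^ (n - 1) : ℕ) = ((R / p ^ (n - 1 - k) : ℕ) : ℤ) := by
  have e : p ^ (n - 1) = p ^ (n - 1 - k) * p ^ k := by rw [← pow_add]; congr 1; omega
  rw [e]
  norm_cast
  exact Nat.mul_div_mul_right _ _ (pow_pos hp.out.pos k)

theorem trunc_add_coeff {n : ℕ} (R : ℕ) (x y : TruncatedWittVector p n L) (i : Fin n)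
    (hx : ∀ k : Fin n, k ≤ i → D.Ge (-((R / p ^ (n - 1 - (k : ℕ)) : ℕ) : ℤ)) (x.coeff k))
    (hy : ∀ k : Fin n, k ≤ i → D.Ge (-((R / p ^ (n - 1 - (k : ℕ)) : ℕ) : ℤ)) (y.coeff k)) :
    D.Ge (-((R / p ^ (n - 1 - (i : ℕ)) : ℕ) : ℤ)) ((x + y).coeff i) := by
  have key : ∀ x : TruncatedWittVector p n L, (TruncatedWittVector.truncate (p := p) (R := L)
      (show (i : ℕ) + 1 ≤ n from i.isLt) x).coeff ⟨i, Nat.lt_succ_self _⟩ = x.coeff i := by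
    intro x
    rw [TruncatedWittVector.coeff_truncate]; rfl
  rw [← key, map_add, trunc_out_coeff, trunc_out_coeff, ← map_add, WittVector.coeff_truncate]
  have := witt_add' (D := D) (p := p) (p ^ (n - 1)) R (pow_pos hp.out.pos _)
    (WittVector.mk p fun k => if h : k ≤ (i : ℕ) then x.coeff ⟨k, by omega⟩ else 0)
    (WittVector.mk p fun k => if h : k ≤ (i : ℕ) then y.coeff ⟨k, by omega⟩ else 0)
    ?_ ?_ i
  · rw [div_cast i.isLt] at this
    exact this
  · intro k
    rw [WittVector.coeff_mk]
    split_ifs with h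
    · rw [div_cast (lt_of_le_of_lt h i.isLt)]; exact hx ⟨k, by omega⟩ h
    · exact Ge.zero _
  · intro k
    rw [WittVector.coeff_mk]
    split_ifs with h
    · rw [div_cast (lt_of_le_of_lt h i.isLt)]; exact hy ⟨k, by omega⟩ h
    · exact Ge.zero _

/-- The bound on the `i`-th component in `fil_r W_n`. -/
def kmB (p r n i : ℕ) : ℕ := (if p ^ (n - i) ∣ r then r else r - 1) / p ^ (n - 1 - i)

/-- Component description of `fil_r W_n`. -/
def kmS (D : DVField L) (p r n : ℕ) : Set (TruncatedWittVector p n L) :=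
  {x | ∀ i : Fin n, D.Ge (-(kmB p r n i : ℤ)) (x.coeff i)}

theorem kmB_le (r n i : ℕ) : kmB p r n i ≤ r / p ^ (n - 1 - i) := by
  unfold kmB
  split_ifs
  · exact le_rfl
  · exact Nat.div_le_div_right (Nat.sub_le _ _)

theorem le_kmB (r n i : ℕ) : (r - 1) / p ^ (n - 1 - i) ≤ kmB p r n i := by
  unfold kmB
  split_ifs
  · exact Nat.div_le_div_right (Nat.sub_le _ _)
  · exact le_rfl

theorem kmS_add {r n : ℕ} {x y : TruncatedWittVector p n L} (hx : x ∈ kmS D p r n)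
    (hy : y ∈ kmS D p r n) : x + y ∈ kmS D p r n := by
  intro i
  by_cases h : p ^ (n - (i : ℕ)) ∣ r
  · have e : kmB p r n i = r / p ^ (n - 1 - (i : ℕ)) := by simp [kmB, h]
    rw [e]
    exact trunc_add_coeff r x y i
      (fun k _ => (hx k).mono (by have := kmB_le (p := p) r n k; omega))
      (fun k _ => (hy k).mono (by have := kmB_le (p := p) r n k; omega))
  · have e : ∀ k : Fin n, k ≤ i → kmB p r n k = (r - 1) / p ^ (n - 1 - (k : ℕ)) := by
      intro k hk
      have : ¬ p ^ (n - (k : ℕ)) ∣ r := fun h' => h ((pow_dvd_pow p (by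
        have : (k : ℕ) ≤ i := hk
        omega)).trans h')
      simp [kmB, this]
    rw [e i le_rfl]
    exact trunc_add_coeff (r - 1) x y i
      (fun k hk => by rw [← e k hk]; exact hx k) (fun k hk => by rw [← e k hk]; exact hy k)

theorem kmS_zero {r n : ℕ} : (0 : TruncatedWittVector p n L) ∈ kmS D p r n := by
  intro i
  rw [TruncatedWittVector.coeff_zero]
  exact Ge.zero _

theorem dvd_iff_min {r n : ℕ} (hr : r ≠ 0) (i : Fin n) :
    p ^ (n - (i : ℕ)) ∣ r ↔ n - min (padicValNat p r) n ≤ (i : ℕ) := by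
  rw [padicValNat_dvd_iff_le hr]
  have := i.isLt
  omega

theorem mem_filKM_iff {r n : ℕ} (hr : r ≠ 0) {x : TruncatedWittVector p n L} :
    x ∈ D.filKM p r n ↔ x ∈ kmS D p r n := by
  rw [filKM, if_neg hr]
  set m := min (padicValNat p r) n with hm
  have hmn : m ≤ n := min_le_right _ _
  constructor
  · rintro ⟨a, ha, b, hb, rfl⟩
    rw [mem_filLog_iff] at ha hb
    refine kmS_add (fun i => (ha i).mono ?_) (fun i => ?_)
    · have := le_kmB (p := p) r n i
      omega
    · rw [wVit, TruncatedWittVector.coeff_mk]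
      split_ifs with h
      · refine (hb _).mono ?_
        have h1 : p ^ (n - (i : ℕ)) ∣ r := (dvd_iff_min hr i).mpr h.1
        have h2 : m - 1 - ((i : ℕ) - (n - m)) = n - 1 - i := by omega
        simp only [kmB, h1, if_true, h2]
        exact le_rfl
      · exact Ge.zero _
  · intro hx
    refine ⟨TruncatedWittVector.mk p fun i => if n - m ≤ (i : ℕ) then 0 else x.coeff i, ?_,
      TruncatedWittVector.mk p fun j => x.coeff ⟨j + (n - m), by have := j.isLt; omega⟩, ?_, ?_⟩
    · rw [mem_filLog_iff]
      intro i
      rw [TruncatedWittVector.coeff_mk]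
      split_ifs with h
      · exact Ge.zero _
      · have h1 : ¬ p ^ (n - (i : ℕ)) ∣ r := fun h' => h ((dvd_iff_min hr i).mp h')
        have := hx i
        simp only [kmB, h1, if_false] at this
        exact this
    · rw [mem_filLog_iff]
      intro i
      rw [TruncatedWittVector.coeff_mk]
      refine (hx _).mono ?_
      have := kmB_le (p := p) r n (i + (n - m))
      have h2 : n - 1 - ((i : ℕ) + (n - m)) = m - 1 - i := by have := i.isLt; omega
      rw [h2] at this
      simp only
      omega
    · have key : ∀ a b : TruncatedWittVector p n L,
          (∀ i, a.coeff i = 0 ∨ b.coeff i = 0) → (∀ i, x.coeff i = a.coeff i + b.coeff i) →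
          x = a + b := by
        intro a b h0 h
        have hsum : a + b = WittVector.truncate n (a.out + b.out) := by
          rw [map_add]
          congr 1
          · ext i; rw [WittVector.coeff_truncate, TruncatedWittVector.coeff_out]
          · ext i; rw [WittVector.coeff_truncate, TruncatedWittVector.coeff_out]
        rw [hsum]
        ext i
        rw [WittVector.coeff_truncate, WittVector.coeff_add_of_disjoint,
          TruncatedWittVector.coeff_out, TruncatedWittVector.coeff_out, h i]
        intro k
        by_cases hk : k < n
        · rcases h0 ⟨k, hk⟩ with h0 | h0
          · left; rw [← h0, ← TruncatedWittVector.coeff_out]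
          · right; rw [← h0, ← TruncatedWittVector.coeff_out]
        · left; simp [TruncatedWittVector.out, hk]
      refine key _ _ (fun i => ?_) (fun i => ?_)
      · rw [wVit, TruncatedWittVector.coeff_mk, TruncatedWittVector.coeff_mk]
        by_cases h : n - m ≤ (i : ℕ)
        · left; rw [if_pos h]
        · right; rw [dif_neg fun h' => h h'.1]
      · rw [wVit, TruncatedWittVector.coeff_mk, TruncatedWittVector.coeff_mk]
        by_cases h : n - m ≤ (i : ℕ)
        · rw [if_pos h, dif_pos ⟨h, by have := i.isLt; omega⟩, TruncatedWittVector.coeff_mk, zero_add]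
          congr 1
          ext
          simp only
          omega
        · rw [if_neg h, dif_neg fun h' => h h'.1, add_zero]

theorem filKM_zero_mem {r n : ℕ} (hr : r ≠ 0) :
    (0 : TruncatedWittVector p n L) ∈ D.filKM p r n := (mem_filKM_iff hr).mpr kmS_zero

theorem filKM_add {r n : ℕ} (hr : r ≠ 0) {x y : TruncatedWittVector p n L}
    (hx : x ∈ D.filKM p r n) (hy : y ∈ D.filKM p r n) : x + y ∈ D.filKM p r n := by
  rw [mem_filKM_iff hr] at *
  exact kmS_add hx hy

theorem FilP_add {r n : ℕ} (hr : r ≠ 0) {x y : TruncatedWittVector p n L}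
    (hx : x ∈ D.FilP p r n) (hy : y ∈ D.FilP p r n) : x + y ∈ D.FilP p r n := by
  obtain ⟨f, hf, rfl⟩ := hx
  obtain ⟨g, hg, rfl⟩ := hy
  refine ⟨fun s => f s + g s, fun s => filKM_add ?_ (hf s) (hg s), ?_⟩
  · exact mul_ne_zero hr (pow_ne_zero _ hp.out.ne_zero)
  · simp only [smul_add, Finset.sum_add_distrib]

theorem filKM_sub_FilP {r n : ℕ} (hr : r ≠ 0) {x : TruncatedWittVector p n L}
    (hx : x ∈ D.filKM p r n) : x ∈ D.FilP p r n := by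
  cases n with
  | zero => exact ⟨fun _ => 0, fun s => s.elim0, by ext i; exact i.elim0⟩
  | succ n =>
    refine ⟨Fin.cons x fun _ => 0, fun s => ?_, ?_⟩
    · refine Fin.cases ?_ (fun s => ?_) s
      · simpa using hx
      · simpa using filKM_zero_mem (mul_ne_zero hr (pow_ne_zero _ hp.out.ne_zero))
    · simp [Fin.sum_univ_succ]

theorem filKM_wR {r n : ℕ} (hr : r ≠ 0) {x : TruncatedWittVector p (n + 1) L}
    (hx : x ∈ D.filKM p (r * p) (n + 1)) : wR x ∈ D.filKM p r n := by
  rw [mem_filKM_iff (mul_ne_zero hr hp.out.ne_zero)] at hx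
  rw [mem_filKM_iff hr]
  intro i
  rw [wR, TruncatedWittVector.coeff_mk]
  refine (hx _).mono ?_
  have hi := i.isLt
  have e1 : n + 1 - ((i.castSucc : Fin (n + 1)) : ℕ) = (n - i) + 1 := by
    rw [Fin.val_castSucc]; omega
  have e2 : n + 1 - 1 - ((i.castSucc : Fin (n + 1)) : ℕ) = (n - 1 - i) + 1 := by
    rw [Fin.val_castSucc]; omega
  have hle : kmB p (r * p) (n + 1) (i.castSucc : Fin (n + 1)) ≤ kmB p r n i := by
    unfold kmB
    rw [e1, e2, pow_succ, pow_succ, mul_comm (p ^ (n - (i : ℕ))) p,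
      mul_comm (p ^ (n - 1 - (i : ℕ))) p, ← Nat.div_div_eq_div_mul]
    have hd : p * p ^ (n - (i : ℕ)) ∣ r * p ↔ p ^ (n - (i : ℕ)) ∣ r := by
      rw [mul_comm p, Nat.mul_dvd_mul_iff_right hp.out.pos]
    by_cases h : p ^ (n - (i : ℕ)) ∣ r
    · rw [if_pos h, if_pos (hd.mpr h), Nat.mul_div_cancel _ hp.out.pos]
    · rw [if_neg h, if_neg (fun h' => h (hd.mp h'))]
      refine Nat.div_le_div_right ?_
      have h2 : r * p - 1 < r * p := Nat.sub_lt (Nat.mul_pos (Nat.pos_of_ne_zero hr) hp.out.pos) one_pos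
      have := (Nat.div_lt_iff_lt_mul hp.out.pos).mpr h2
      omega
  omega

theorem wP_zero [CharP L p] {n : ℕ} : wP (0 : TruncatedWittVector p n L) = 0 := by
  ext i
  rw [TruncatedWittVector.coeff_zero]
  refine Fin.cases ?_ (fun i => ?_) i
  · exact wP_coeff_zero _
  · rw [wP_coeff_succ, TruncatedWittVector.coeff_zero, zero_pow hp.out.ne_zero]

/-- `wP` as an additive homomorphism. -/
def wPHom [CharP L p] (n : ℕ) :
    TruncatedWittVector p n L →+ TruncatedWittVector p (n + 1) L where
  toFun := wP
  map_zero' := wP_zero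
  map_add' := wP_add

theorem FilP_decomp [CharP L p] {r m : ℕ} (hr : r ≠ 0) {x : TruncatedWittVector p (m + 1) L}
    (hx : x ∈ D.FilP p r (m + 1)) :
    ∃ f0 ∈ D.filKM p r (m + 1), ∃ c ∈ D.FilP p r m, x = f0 + wP c := by
  obtain ⟨f, hf, rfl⟩ := hx
  refine ⟨f 0, by simpa using hf 0, ∑ s : Fin m, p ^ (s : ℕ) • wR (f s.succ),
    ⟨fun s => wR (f s.succ), fun s => ?_, rfl⟩, ?_⟩
  · refine filKM_wR (mul_ne_zero hr (pow_ne_zero _ hp.out.ne_zero)) ?_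
    have := hf s.succ
    rw [Fin.val_succ, pow_succ, ← mul_assoc] at this
    exact this
  · rw [Fin.sum_univ_succ]
    congr 1
    · simp
    · change _ = wPHom m _
      rw [map_sum]
      refine Finset.sum_congr rfl fun s _ => ?_
      rw [map_nsmul]
      change _ = _ • wP (wR _)
      rw [← p_nsmul_eq_wP_wR, Fin.val_succ, pow_succ, mul_smul]

end KM

end DVField

namespace DVField

section Embed

variable {L : Type} [Field L] (D : DVField L) (K : Subfield L)

/-- The residue map to the coefficient field. -/
def rho (a : L) : K := if h : ∃ μ : K, D.Ge 1 (a - μ) then h.choose else 0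

/-- The shift map. -/
def sig (a : L) : L := D.z ^ (-1 : ℤ) * (a - D.rho K a)

/-- The Taylor coefficients. -/
def cf : ℕ → L → K
  | 0, a => D.rho K a
  | N + 1, a => cf N (D.sig K a)

variable {D K}

theorem eq_zero_of_ge_one (hK : D.IsCoeffField K) {a : L} (ha : a ∈ K) (h : D.Ge 1 a) : a = 0 := by
  by_contra h0
  have h1 : D.Ge 0 a⁻¹ := by simpa [Ge] using hK.1 _ (K.inv_mem ha)
  have h2 := h.mul h1
  rw [mul_inv_cancel₀ h0, Ge, v_one] at h2
  exact absurd h2 (by decide)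

theorem rho_spec (hK : D.IsCoeffField K) {a : L} (ha : D.Ge 0 a) : D.Ge 1 (a - D.rho K a) := by
  have h : ∃ μ : K, D.Ge 1 (a - μ) := by
    obtain ⟨μ, hμ, h⟩ := hK.2 a (by simpa [Ge] using ha)
    exact ⟨⟨μ, hμ⟩, by simpa [Ge] using h⟩
  rw [rho, dif_pos h]
  exact h.choose_spec

theorem rho_unique (hK : D.IsCoeffField K) {a : L} (ha : D.Ge 0 a) {μ : K}
    (h : D.Ge 1 (a - μ)) : D.rho K a = μ := by
  have h1 := (rho_spec hK ha).sub h
  rw [sub_sub_sub_cancel_left] at h1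
  have h2 := eq_zero_of_ge_one hK (K.sub_mem μ.2 (D.rho K a).2) h1
  ext
  rw [← sub_eq_zero, ← neg_eq_zero, neg_sub, h2]

theorem coe_ge (hK : D.IsCoeffField K) (μ : K) : D.Ge 0 (μ : L) := by
  simpa [Ge] using hK.1 _ μ.2

theorem rho_coe (hK : D.IsCoeffField K) (μ : K) : D.rho K (μ : L) = μ :=
  rho_unique hK (coe_ge hK μ) (by rw [sub_self]; exact Ge.zero _)

theorem sig_ge (hK : D.IsCoeffField K) {a : L} (ha : D.Ge 0 a) : D.Ge 0 (D.sig K a) :=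
  (Ge.zpow_mul (rho_spec hK ha)).mono (by omega)

theorem rho_add (hK : D.IsCoeffField K) {a b : L} (ha : D.Ge 0 a) (hb : D.Ge 0 b) :
    D.rho K (a + b) = D.rho K a + D.rho K b := by
  refine rho_unique hK (ha.add hb) ?_
  have := (rho_spec hK ha).add (rho_spec hK hb)
  convert this using 1
  push_cast; ring

theorem rho_mul (hK : D.IsCoeffField K) {a b : L} (ha : D.Ge 0 a) (hb : D.Ge 0 b) :
    D.rho K (a * b) = D.rho K a * D.rho K b := by
  refine rho_unique hK ((ha.mul hb).mono (by omega)) ?_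
  have := ((rho_spec hK ha).mul hb).add ((coe_ge hK (D.rho K a)).mul (rho_spec hK hb))
  refine (Eq.subst (motive := fun t => D.Ge _ t) ?_ this).mono (by omega)
  rw [show ((D.rho K a * D.rho K b : K) : L) = D.rho K a * D.rho K b from rfl]
  ring

theorem sig_add (hK : D.IsCoeffField K) {a b : L} (ha : D.Ge 0 a) (hb : D.Ge 0 b) :
    D.sig K (a + b) = D.sig K a + D.sig K b := by
  rw [sig, sig, sig, rho_add hK ha hb]
  push_cast; ring

theorem sig_mul (hK : D.IsCoeffField K) {a b : L} (ha : D.Ge 0 a) (hb : D.Ge 0 b) :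
    D.sig K (a * b) = D.sig K a * b + D.rho K a * D.sig K b := by
  rw [sig, sig, sig, rho_mul hK ha hb]
  push_cast; ring

theorem cf_add (hK : D.IsCoeffField K) (N : ℕ) {a b : L} (ha : D.Ge 0 a) (hb : D.Ge 0 b) :
    D.cf K N (a + b) = D.cf K N a + D.cf K N b := by
  induction N generalizing a b with
  | zero => exact rho_add hK ha hb
  | succ N ih => rw [cf, sig_add hK ha hb, ih (sig_ge hK ha) (sig_ge hK hb)]; rfl

theorem sig_coe (hK : D.IsCoeffField K) (μ : K) : D.sig K (μ : L) = 0 := by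
  rw [sig, rho_coe hK, sub_self, mul_zero]

theorem cf_zero (hK : D.IsCoeffField K) (N : ℕ) : D.cf K N 0 = 0 := by
  have := cf_add hK N (Ge.zero (D := D) 0) (Ge.zero 0)
  rw [add_zero] at this
  simpa using this

/-- The Taylor expansion. -/
def tay (D : DVField L) (K : Subfield L) (a : L) : PowerSeries K := PowerSeries.mk fun N => D.cf K N a

theorem tay_add (hK : D.IsCoeffField K) {a b : L} (ha : D.Ge 0 a) (hb : D.Ge 0 b) :
    D.tay K (a + b) = D.tay K a + D.tay K b := by
  ext1 N
  simp [tay, cf_add hK N ha hb]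

theorem tay_eq (a : L) : D.tay K a =
    PowerSeries.C (D.rho K a) + PowerSeries.X * D.tay K (D.sig K a) := by
  ext1 N
  cases N with
  | zero => simp [tay, cf]
  | succ N => simp [tay, cf, PowerSeries.coeff_succ_X_mul]

theorem tay_zero (hK : D.IsCoeffField K) : D.tay K 0 = 0 := by
  ext1 N; simp [tay, cf_zero hK]

theorem tay_coe (hK : D.IsCoeffField K) (μ : K) : D.tay K (μ : L) = PowerSeries.C μ := by
  rw [tay_eq, rho_coe hK, sig_coe hK, tay_zero hK, mul_zero, add_zero]

theorem tay_mul (hK : D.IsCoeffField K) {a b : L} (ha : D.Ge 0 a) (hb : D.Ge 0 b) :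
    D.tay K (a * b) = D.tay K a * D.tay K b := by
  ext1 N
  induction N generalizing a b with
  | zero =>
    rw [tay_eq (a * b), tay_eq a, tay_eq b]
    simp [rho_mul hK ha hb]
  | succ N ih =>
    have h1 := sig_ge hK ha
    have h2 := sig_ge hK hb
    have h3 : D.Ge 0 ((D.rho K a : L) * D.sig K b) := ((coe_ge hK _).mul h2).mono (by omega)
    rw [tay_eq (a * b), map_add, PowerSeries.coeff_succ_X_mul, sig_mul hK ha hb,
      tay_add hK ((h1.mul hb).mono (by omega)) h3, map_add, ih h1 hb, ih (coe_ge hK _) h2,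
      tay_coe hK, tay_eq a, add_mul, map_add, mul_assoc, PowerSeries.coeff_succ_X_mul,
      PowerSeries.coeff_C_mul, PowerSeries.coeff_C_mul]
    nth_rewrite 2 [tay_eq b]
    rw [map_add, PowerSeries.coeff_succ_X_mul]
    simp [PowerSeries.coeff_C]
    ring

theorem tay_z (hK : D.IsCoeffField K) : D.tay K D.z = PowerSeries.X := by
  have hz : D.Ge 1 D.z := by simpa using Ge.zpow (D := D) 1
  have h1 : D.rho K D.z = 0 := rho_unique hK (hz.mono (by omega)) (by simpa using hz)
  have h2 : D.sig K D.z = ((1 : K) : L) := by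
    rw [sig, h1]
    simp [D.z_ne_zero]
  rw [tay_eq, h1, h2, tay_coe hK]
  simp

/-- The valuation ring. -/
def vO (D : DVField L) : ValuationSubring L where
  carrier := {a | D.Ge 0 a}
  mul_mem' := fun ha hb => (Ge.mul ha hb).mono (by omega)
  one_mem' := Ge.one
  add_mem' := fun ha hb => Ge.add ha hb
  zero_mem' := Ge.zero _
  neg_mem' := fun ha => Ge.neg ha
  mem_or_inv_mem' := by
    intro x
    by_cases hx : x = 0
    · left; subst hx; exact Ge.zero _
    obtain ⟨k, hk⟩ := D.v_ne_top hx
    obtain ⟨j, hj⟩ := D.v_ne_top (inv_ne_zero hx)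
    have h := D.v_mul x x⁻¹
    rw [mul_inv_cancel₀ hx, v_one, hk, hj] at h
    norm_cast at h
    change D.Ge 0 x ∨ D.Ge 0 x⁻¹
    rw [Ge, Ge, hk, hj, WithTop.coe_le_coe, WithTop.coe_le_coe]
    omega

/-- The Taylor expansion as a ring homomorphism. -/
def tayHom (hK : D.IsCoeffField K) : D.vO →+* LaurentSeries K :=
  (HahnSeries.ofPowerSeries ℤ K).comp
    { toFun := fun a => D.tay K (a : L)
      map_one' := by simpa using tay_coe hK 1
      map_mul' := fun a b => tay_mul hK a.2 b.2
      map_zero' := tay_zero hK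
      map_add' := fun a b => tay_add hK a.2 b.2 }

theorem tay_ne_zero (hK : D.IsCoeffField K) {a : L} (ha : D.Ge 0 a) (h : D.tay K a = 0) : a = 0 := by
  by_contra h0
  obtain ⟨k, hk⟩ := D.v_ne_top h0
  have hk0 : 0 ≤ k := by rw [Ge, hk, WithTop.coe_le_coe] at ha; exact ha
  lift k to ℕ using hk0
  have h1 : D.Ge k a := by rw [Ge, hk]
  obtain ⟨u, hu, rfl⟩ := h1.exists_unit
  rw [zpow_natCast] at h hk
  have hz : D.Ge 0 D.z := (by simpa using Ge.zpow (D := D) 1 : D.Ge 1 D.z).mono (by omega)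
  have h2 : ∀ k : ℕ, D.tay K (D.z ^ k * u) = PowerSeries.X ^ k * D.tay K u := by
    intro k
    induction k with
    | zero => simp
    | succ k ih =>
      rw [pow_succ', mul_assoc, tay_mul hK hz, ih, tay_z hK, pow_succ', mul_assoc]
      have := (hz.pow k).mul hu
      exact this.mono (by simp)
  rw [h2, mul_eq_zero] at h
  rcases h with h | h
  · exact pow_ne_zero _ PowerSeries.X_ne_zero h
  · rw [tay_eq] at h
    have h3 := congrArg (PowerSeries.coeff 0) h
    simp at h3
    have h4 := rho_spec hK hu
    rw [h3] at h4
    have h5 := (Ge.zpow (D := D) k).mul h4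
    simp only [ZeroMemClass.coe_zero, sub_zero, zpow_natCast] at h5
    rw [Ge, hk, WithTop.coe_le_coe] at h5
    omega

theorem tayHom_inj (hK : D.IsCoeffField K) : Function.Injective (tayHom hK) := by
  rw [injective_iff_map_eq_zero]
  intro a h
  have h1 : D.tay K (a : L) = 0 := by
    apply HahnSeries.ofPowerSeries_injective (Γ := ℤ)
    rw [map_zero]
    exact h
  exact Subtype.ext (tay_ne_zero hK a.2 h1)

/-- The embedding of `L` into Laurent series over the coefficient field. -/
def psi (hK : D.IsCoeffField K) : L →+* LaurentSeries K := IsFractionRing.lift (tayHom_inj hK)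

theorem psi_of_ge (hK : D.IsCoeffField K) {a : L} (ha : D.Ge 0 a) :
    psi hK a = HahnSeries.ofPowerSeries ℤ K (D.tay K a) :=
  IsFractionRing.lift_algebraMap (tayHom_inj hK) (⟨a, ha⟩ : D.vO)

theorem psi_coe (hK : D.IsCoeffField K) (μ : K) : psi hK (μ : L) = HahnSeries.C μ := by
  rw [psi_of_ge hK (coe_ge hK μ), tay_coe hK, HahnSeries.ofPowerSeries_C]

theorem psi_zpow (hK : D.IsCoeffField K) (N : ℤ) : psi hK (D.z ^ N) = HahnSeries.single N 1 := by
  have hz : D.Ge 0 D.z := (by simpa using Ge.zpow (D := D) 1 : D.Ge 1 D.z).mono (by omega)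
  rw [map_zpow₀, psi_of_ge hK hz, tay_z hK, HahnSeries.ofPowerSeries_X]
  exact (RatFunc.single_zpow (F := K) N).symm

theorem psi_coeff_of_ge (hK : D.IsCoeffField K) {a : L} {N : ℤ} (ha : D.Ge N a) {j : ℤ}
    (hj : j < N) : (psi hK a).coeff j = 0 := by
  obtain ⟨u, hu, rfl⟩ := ha.exists_unit
  rw [map_mul, psi_zpow, HahnSeries.coeff_single_mul, psi_of_ge hK hu, one_mul,
    HahnSeries.ofPowerSeries_apply]
  apply HahnSeries.embDomain_of_notMem_range
  rintro ⟨k, hk⟩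
  simp at hk
  omega

theorem psi_coeff_lead (hK : D.IsCoeffField K) {a : L} {N : ℤ} {μ : K}
    (ha : D.Ge (N + 1) (a - μ * D.z ^ N)) : (psi hK a).coeff N = μ := by
  have h := psi_coeff_of_ge hK ha (lt_add_one N)
  rw [map_sub, map_mul, psi_zpow, psi_coe, HahnSeries.coeff_sub, HahnSeries.coeff_mul_single] at h
  simp at h
  rw [sub_eq_zero] at h
  rw [h]

end Embed

end DVField

section Deriv

/-- Pushing Kähler differentials forward along a ring map and a derivation of the target. -/
theorem exists_kaehler_push {A S : Type} [CommRing A] [CommRing S] (ψ : A →+* S) (δ : S →+ S)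
    (hδ : ∀ a b, δ (a * b) = a * δ b + b * δ a) :
    ∃ τ : Ω[A⁄ℤ] →+ S, (∀ a, τ (KaehlerDifferential.D ℤ A a) = δ (ψ a)) ∧
      ∀ a ω, τ (a • ω) = ψ a * τ ω := by
  let _ : Algebra A S := ψ.toAlgebra
  let d : Derivation ℤ A S := Derivation.mk' (δ.comp ψ.toAddMonoidHom).toIntLinearMap (by
    intro a b
    change δ (ψ (a * b)) = ψ a * δ (ψ b) + ψ b * δ (ψ a)
    rw [map_mul, hδ])
  refine ⟨d.liftKaehlerDifferential.toAddMonoidHom, fun a => ?_, fun a ω => ?_⟩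
  · exact Derivation.liftKaehlerDifferential_comp_D d a
  · exact map_smul d.liftKaehlerDifferential a ω

variable {K : Type} [Field K]

/-- The derivation `Σ f_j z^j ↦ Σ (δ f_j + c j f_j) z^j` on Laurent series. -/
def lauD (δ : K →+ K) (c : K) : LaurentSeries K →+ LaurentSeries K where
  toFun f := ⟨fun j => δ (f.coeff j) + c * j * f.coeff j, f.isPWO_support.mono (by
    intro j hj
    rw [Function.mem_support] at hj
    rw [HahnSeries.mem_support]
    intro h
    apply hj
    simp [h])⟩
  map_zero' := by ext j; simp
  map_add' f g := by ext j; simp; ring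

theorem lauD_coeff (δ : K →+ K) (c : K) (f : LaurentSeries K) (j : ℤ) :
    (lauD δ c f).coeff j = δ (f.coeff j) + c * j * f.coeff j := rfl

theorem lauD_support (δ : K →+ K) (c : K) (f : LaurentSeries K) :
    (lauD δ c f).support ⊆ f.support := by
  intro j hj
  rw [HahnSeries.mem_support] at hj ⊢
  intro h
  apply hj
  simp [lauD_coeff, h]

theorem lauD_mul (δ : K →+ K) (c : K) (hδ : ∀ a b, δ (a * b) = a * δ b + b * δ a)
    (f g : LaurentSeries K) : lauD δ c (f * g) = f * lauD δ c g + g * lauD δ c f := by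
  rw [mul_comm g]
  ext j
  rw [HahnSeries.coeff_add, HahnSeries.coeff_mul_left' f.isPWO_support (lauD_support δ c f),
    HahnSeries.coeff_mul_right' g.isPWO_support (lauD_support δ c g), lauD_coeff,
    HahnSeries.coeff_mul, map_sum, Finset.mul_sum, ← Finset.sum_add_distrib,
    ← Finset.sum_add_distrib]
  refine Finset.sum_congr rfl fun ij hij => ?_
  have h : ij.1 + ij.2 = j := (Finset.mem_antidiagonal.mp hij).2.2
  rw [hδ, lauD_coeff, lauD_coeff, ← h]
  push_cast
  ring

/-- Coefficient vanishing below `N`. -/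
def LGe (N : ℤ) (f : LaurentSeries K) : Prop := ∀ j, j < N → f.coeff j = 0

theorem LGe.mono {N M : ℤ} {f : LaurentSeries K} (h : LGe N f) (hM : M ≤ N) : LGe M f :=
  fun j hj => h j (by omega)

theorem LGe.add {N : ℤ} {f g : LaurentSeries K} (h : LGe N f) (h' : LGe N g) : LGe N (f + g) :=
  fun j hj => by rw [HahnSeries.coeff_add, h j hj, h' j hj, add_zero]

theorem LGe.neg {N : ℤ} {f : LaurentSeries K} (h : LGe N f) : LGe N (-f) :=
  fun j hj => by rw [HahnSeries.coeff_neg, h j hj, neg_zero]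

theorem LGe.sub {N : ℤ} {f g : LaurentSeries K} (h : LGe N f) (h' : LGe N g) : LGe N (f - g) := by
  rw [sub_eq_add_neg]; exact h.add h'.neg

theorem LGe.zero {N : ℤ} : LGe N (0 : LaurentSeries K) := fun j _ => rfl

theorem LGe.sum {N : ℤ} {ι : Type*} (s : Finset ι) (f : ι → LaurentSeries K)
    (h : ∀ i ∈ s, LGe N (f i)) : LGe N (∑ i ∈ s, f i) := by
  intro j hj
  rw [HahnSeries.coeff_sum]
  exact Finset.sum_eq_zero fun i hi => h i hi j hj

theorem LGe.mul {N M : ℤ} {f g : LaurentSeries K} (h : LGe N f) (h' : LGe M g) :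
    LGe (N + M) (f * g) := by
  intro j hj
  rw [HahnSeries.coeff_mul]
  refine Finset.sum_eq_zero fun ij hij => ?_
  have e : ij.1 + ij.2 = j := (Finset.mem_antidiagonal.mp hij).2.2
  by_cases h1 : ij.1 < N
  · rw [h _ h1, zero_mul]
  · rw [h' ij.2 (by omega), mul_zero]

theorem LGe.single (N : ℤ) (c : K) : LGe N (HahnSeries.single N c : LaurentSeries K) := by
  intro j hj
  rw [HahnSeries.coeff_single_of_ne (by omega)]

theorem LGe.lauD_ge {N : ℤ} {f : LaurentSeries K} (h : LGe N f) (δ : K →+ K) (c : K) :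
    LGe N (lauD δ c f) := by
  intro j hj
  rw [lauD_coeff, h j hj]; simp

end Deriv

section Lead

variable {K : Type} [Field K]

theorem LGe.coeff_mul {N M : ℤ} {f g : LaurentSeries K} (h : LGe N f) (h' : LGe M g) :
    (f * g).coeff (N + M) = f.coeff N * g.coeff M := by
  have hf : LGe (N + 1) (f - HahnSeries.single N (f.coeff N)) := by
    intro j hj
    rw [HahnSeries.coeff_sub]
    by_cases hjN : j = N
    · subst hjN; simp
    · rw [h j (by omega), HahnSeries.coeff_single_of_ne hjN, sub_zero]
  have h1 := (hf.mul h') (N + M) (by omega)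
  rw [sub_mul, HahnSeries.coeff_sub, HahnSeries.coeff_single_mul, add_sub_cancel_left,
    sub_eq_zero] at h1
  exact h1

theorem LGe.one : LGe 0 (1 : LaurentSeries K) := by
  have := LGe.single 0 (1 : K)
  exact this

theorem LGe.pow {N : ℤ} {f : LaurentSeries K} (h : LGe N f) (k : ℕ) : LGe (k * N) (f ^ k) := by
  induction k with
  | zero => simpa using LGe.one
  | succ k ih => rw [pow_succ]; exact (ih.mul h).mono (by push_cast; linarith)

theorem LGe.coeff_pow {N : ℤ} {f : LaurentSeries K} (h : LGe N f) (k : ℕ) :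
    (f ^ k).coeff (k * N) = f.coeff N ^ k := by
  induction k with
  | zero => simp
  | succ k ih =>
    have e : ((k + 1 : ℕ) : ℤ) * N = k * N + N := by push_cast; ring
    rw [pow_succ, e, (h.pow k).coeff_mul h, ih, pow_succ]

/-- Terms of `F^{n-1}d` under the Laurent derivation. -/
theorem LGe.term {N : ℤ} {f : LaurentSeries K} (h : LGe N f) (δ : K →+ K) (c : K) {e : ℕ}
    (he : e ≠ 0) : LGe (e * N) (f ^ (e - 1) * lauD δ c f) := by
  refine ((h.pow (e - 1)).mul (h.lauD_ge δ c)).mono (le_of_eq ?_)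
  obtain ⟨e, rfl⟩ := Nat.exists_eq_succ_of_ne_zero he
  simp; ring

theorem LGe.term_coeff {N : ℤ} {f : LaurentSeries K} (h : LGe N f) (δ : K →+ K) (c : K) {e : ℕ}
    (he : e ≠ 0) : (f ^ (e - 1) * lauD δ c f).coeff (e * N) =
      f.coeff N ^ (e - 1) * (δ (f.coeff N) + c * N * f.coeff N) := by
  have e1 : (e : ℤ) * N = ((e - 1 : ℕ) : ℤ) * N + N := by
    obtain ⟨e, rfl⟩ := Nat.exists_eq_succ_of_ne_zero he
    simp; ring
  rw [e1, (h.pow (e - 1)).coeff_mul (h.lauD_ge δ c), h.coeff_pow, lauD_coeff]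

end Lead

section Cartier

variable {p : ℕ} [hp : Fact p.Prime] {K : Type} [Field K] [CharP K p]

theorem exists_max_subfield {x : K} (hx : ∀ y : K, x ≠ y ^ p) :
    ∃ K0 : Subfield K, (∀ y : K, y ^ p ∈ K0) ∧ x ∉ K0 ∧
      ∀ K1 : Subfield K, K0 ≤ K1 → x ∉ K1 → K1 ≤ K0 := by
  let B : Subfield K := (frobenius K p).fieldRange
  let s : Set (Subfield K) := {F | B ≤ F ∧ x ∉ F}
  have hB : B ∈ s := by
    refine ⟨le_rfl, ?_⟩
    rintro ⟨y, hy⟩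
    exact hx y hy.symm
  obtain ⟨K0, hBK, hmax⟩ := zorn_le_nonempty₀ s (by
    intro c hc hchain y hy
    refine ⟨sSup c, ⟨(hc hy).1.trans (le_sSup hy), ?_⟩, fun z hz => le_sSup hz⟩
    rw [Subfield.mem_sSup_of_directedOn ⟨y, hy⟩ hchain.directedOn]
    rintro ⟨F, hF, hxF⟩
    exact (hc hF).2 hxF) B hB
  refine ⟨K0, fun y => hBK ⟨y, rfl⟩, hmax.prop.2, fun K1 h1 h2 => ?_⟩
  exact hmax.le_of_ge ⟨hBK.trans h1, h2⟩ h1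

theorem minpoly_of_notMem {K0 : Subfield K} (hp0 : ∀ y : K, y ^ p ∈ K0) {y : K} (hy : y ∉ K0) :
    minpoly K0 y = Polynomial.X ^ p - Polynomial.C (⟨y ^ p, hp0 y⟩ : K0) := by
  symm
  refine minpoly.eq_of_irreducible_of_monic ?_ ?_ (Polynomial.monic_X_pow_sub_C _ hp.out.ne_zero)
  · refine X_pow_sub_C_irreducible_of_prime hp.out fun b hb => hy ?_
    have h1 : (b : K) ^ p = y ^ p := congrArg Subtype.val hb
    have h2 : (b : K) = y := frobenius_inj K p h1
    rw [← h2]; exact b.2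
  · rw [map_sub, map_pow, Polynomial.aeval_X, Polynomial.aeval_C]
    exact sub_self _

theorem integral_of_pow {K0 : Subfield K} (hp0 : ∀ y : K, y ^ p ∈ K0) (y : K) :
    IsIntegral K0 y := by
  refine ⟨Polynomial.X ^ p - Polynomial.C (⟨y ^ p, hp0 y⟩ : K0),
    Polynomial.monic_X_pow_sub_C _ hp.out.ne_zero, ?_⟩
  rw [← Polynomial.aeval_def, map_sub, map_pow, Polynomial.aeval_X, Polynomial.aeval_C]
  exact sub_self _

theorem aeval_surj {x : K} {K0 : Subfield K} (hp0 : ∀ y : K, y ^ p ∈ K0) (hx : x ∉ K0)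
    (hmax : ∀ K1 : Subfield K, K0 ≤ K1 → x ∉ K1 → K1 ≤ K0) :
    Function.Surjective (Polynomial.aeval x : Polynomial K0 →ₐ[K0] K) := by
  intro y
  have hfr : ∀ w : K, w ∉ K0 → Module.finrank K0 (IntermediateField.adjoin K0 {w}) = p := by
    intro w hw
    rw [IntermediateField.adjoin.finrank (integral_of_pow hp0 w), minpoly_of_notMem hp0 hw,
      Polynomial.natDegree_X_pow_sub_C]
  have hy : y ∈ IntermediateField.adjoin K0 {x} := by
    by_cases hy0 : y ∈ K0
    · exact (IntermediateField.adjoin K0 {x}).algebraMap_mem ⟨y, hy0⟩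
    · have hxy : x ∈ IntermediateField.adjoin K0 {y} := by
        by_contra hxy
        have h := hmax (IntermediateField.adjoin K0 {y}).toSubfield (fun w hw =>
          (IntermediateField.adjoin K0 {y}).algebraMap_mem ⟨w, hw⟩) hxy
        exact hy0 (h (IntermediateField.mem_adjoin_simple_self K0 y))
      have hle : IntermediateField.adjoin K0 {x} ≤ IntermediateField.adjoin K0 {y} :=
        IntermediateField.adjoin_simple_le_iff.mpr hxy
      have : FiniteDimensional K0 (IntermediateField.adjoin K0 {y}) :=
        IntermediateField.adjoin.finiteDimensional (integral_of_pow hp0 y)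
      rw [IntermediateField.eq_of_le_of_finrank_eq hle (by rw [hfr x hx, hfr y hy0])]
      exact IntermediateField.mem_adjoin_simple_self K0 y
  rw [← IntermediateField.mem_toSubalgebra,
    IntermediateField.adjoin_simple_toSubalgebra_of_isAlgebraic (integral_of_pow hp0 x).isAlgebraic,
    Algebra.adjoin_singleton_eq_range_aeval] at hy
  exact hy

theorem iterate_mul_const (δ : Derivation ℤ K K) {c : K} (hc : δ c = 0) (k : ℕ) (y : K) :
    δ^[k] (c * y) = c * δ^[k] y := by
  induction k generalizing y with
  | zero => rfl
  | succ k ih =>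
    rw [Function.iterate_succ_apply, Function.iterate_succ_apply, Derivation.leibniz, hc]
    simp only [smul_eq_mul, mul_zero, add_zero]
    exact ih _

theorem deriv_pow_p (δ : Derivation ℤ K K) (g : K) : δ (g ^ p) = 0 := by
  rw [Derivation.leibniz_pow]
  simp

theorem iterate_add' (δ : Derivation ℤ K K) (k : ℕ) (y w : K) :
    δ^[k] (y + w) = δ^[k] y + δ^[k] w := by
  induction k generalizing y w with
  | zero => rfl
  | succ k ih => simp only [Function.iterate_succ_apply, map_add, ih]

theorem iterate_zero' (δ : Derivation ℤ K K) (k : ℕ) : δ^[k] 0 = 0 := by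
  induction k with
  | zero => rfl
  | succ k ih => simp only [Function.iterate_succ_apply, map_zero, ih]

/-- The additivity of `f ↦ f^(p-1) df` modulo exact forms. -/
theorem pm1_add (δ : Derivation ℤ K K) (f g : K) : ∃ S : K,
    (f + g) ^ (p - 1) * δ (f + g) + δ S = f ^ (p - 1) * δ f + g ^ (p - 1) * δ g := by
  obtain ⟨τ, h1, h2⟩ := exists_kaehler_push (RingHom.id K) (δ : K →ₗ[ℤ] K).toAddMonoidHom
    (by intro a b; exact δ.leibniz a b)
  have h := congrArg τ (wFdInf_add (p := p) 1 (WittVector.teichmuller p f)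
    (WittVector.teichmuller p g))
  refine ⟨(WittVector.teichmuller p f + WittVector.teichmuller p g).coeff 1, ?_⟩
  simp only [wFdInf, Finset.sum_range_succ, Finset.sum_range_zero, map_add, h1, h2,
    WittVector.add_coeff_zero, WittVector.teichmuller_coeff_zero, zero_add] at h
  rw [WittVector.teichmuller_coeff_pos p f 1 one_pos,
    WittVector.teichmuller_coeff_pos p g 1 one_pos] at h
  simpa using h

theorem exists_good_deriv {x : K} (hx : ∀ y : K, x ≠ y ^ p) :
    ∃ δ : Derivation ℤ K K, δ x = 1 ∧ (∀ f, δ^[p] f = 0) ∧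
      ∀ f, δ^[p - 1] (f ^ (p - 1) * δ f) = -(δ f) ^ p := by
  obtain ⟨K0, hp0, hxK, hmax⟩ := exists_max_subfield hx
  have hsurj := aeval_surj hp0 hxK hmax
  have hchar : CharP K0 p := inferInstance
  have hker : ∀ g : Polynomial K0, Polynomial.aeval x g = 0 →
      Polynomial.aeval x (Polynomial.derivative' g) = 0 := by
    intro g hg
    obtain ⟨q, rfl⟩ := minpoly.dvd K0 x hg
    have hd : Polynomial.derivative' (minpoly K0 x) = 0 := by
      rw [minpoly_of_notMem hp0 hxK]
      simp [Polynomial.derivative'_apply, Polynomial.derivative_X_pow]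
    rw [Derivation.leibniz, hd, smul_zero, add_zero, smul_eq_mul, map_mul, minpoly.aeval, zero_mul]
  let δ0 : Derivation K0 K K := Derivation.liftOfSurjective hsurj hker
  have hδ0 : ∀ g : Polynomial K0, δ0 (Polynomial.aeval x g) =
      Polynomial.aeval x (Polynomial.derivative g) := fun g =>
    Derivation.liftOfSurjective_apply hsurj hker g
  let δ : Derivation ℤ K K := δ0.restrictScalars ℤ
  have hδ : ∀ g : Polynomial K0, δ (Polynomial.aeval x g) =
      Polynomial.aeval x (Polynomial.derivative g) := hδ0
  have hit : ∀ (k : ℕ) (g : Polynomial K0), δ^[k] (Polynomial.aeval x g) =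
      Polynomial.aeval x (Polynomial.derivative^[k] g) := by
    intro k
    induction k with
    | zero => intro g; rfl
    | succ k ih => intro g; rw [Function.iterate_succ_apply, hδ, ih, Function.iterate_succ_apply]
  have hconst : ∀ c : K0, δ (c : K) = 0 := fun c => δ0.map_algebraMap c
  have hx1 : δ x = 1 := by
    have := hδ Polynomial.X
    simpa using this
  have hpz : ∀ f, δ^[p] f = 0 := by
    intro f
    obtain ⟨g, rfl⟩ := hsurj f
    rw [hit, ← Polynomial.factorial_smul_hasseDeriv, LinearMap.smul_apply]
    have h0 : ((p.factorial : ℕ) : Polynomial K0) = 0 :=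
      (CharP.cast_eq_zero_iff (Polynomial K0) p _).mpr (hp.out.dvd_factorial.mpr le_rfl)
    rw [nsmul_eq_mul, h0, zero_mul, map_zero]
  have hwil : δ^[p - 1] (x ^ (p - 1)) = -1 := by
    have h := hit (p - 1) (Polynomial.X ^ (p - 1))
    rw [Polynomial.iterate_derivative_X_pow_eq_natCast_mul, Nat.descFactorial_self] at h
    simp only [map_pow, Polynomial.aeval_X, Nat.sub_self, pow_zero, mul_one, map_natCast] at h
    rw [h]
    have h2 := congrArg (ZMod.castHom (dvd_refl p) K) (ZMod.wilsons_lemma p)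
    rwa [map_natCast, map_neg, map_one] at h2
  refine ⟨δ, hx1, hpz, ?_⟩
  have hp1 : p = (p - 1) + 1 := by have := hp.out.pos; omega
  intro f
  obtain ⟨g, rfl⟩ := hsurj f
  induction g using Polynomial.induction_on' with
  | add g1 g2 ih1 ih2 =>
    rw [map_add]
    obtain ⟨S, hS⟩ := pm1_add (p := p) δ (Polynomial.aeval x g1) (Polynomial.aeval x g2)
    have h := congrArg (δ^[p - 1]) hS
    rw [iterate_add', iterate_add', ih1, ih2, ← Function.iterate_succ_apply, Nat.succ_eq_add_one,
      ← hp1, hpz, add_zero] at h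
    rw [h, map_add, add_pow_char]
    ring
  | monomial j c =>
    have e1 : Polynomial.aeval x (Polynomial.monomial j c) = (c : K) * x ^ j := by
      rw [Polynomial.aeval_monomial]; rfl
    rw [e1]
    cases j with
    | zero =>
      rw [pow_zero, mul_one, hconst, mul_zero, iterate_zero', zero_pow hp.out.ne_zero, neg_zero]
    | succ j =>
      have e2 : δ ((c : K) * x ^ (j + 1)) = c * ((j + 1 : ℕ) * x ^ j) := by
        rw [Derivation.leibniz, hconst, Derivation.leibniz_pow, hx1]
        simp
      have hj : ((j + 1 : ℕ) : K) ^ p = ((j + 1 : ℕ) : K) := by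
        have h2 := congrArg (ZMod.castHom (dvd_refl p) K) (ZMod.pow_card ((j + 1 : ℕ) : ZMod p))
        simpa only [map_pow, map_natCast] using h2
      have e3 : ((c : K) * x ^ (j + 1)) ^ (p - 1) * (c * ((j + 1 : ℕ) * x ^ j)) =
          (((j + 1 : ℕ) : K) * (c * x ^ j) ^ p) * x ^ (p - 1) := by
        have e4 : (c * x ^ j) ^ p = (c * x ^ j) ^ (p - 1) * (c * x ^ j) := by
          rw [← pow_succ, ← hp1]
        rw [e4]
        ring
      have e5 : δ (((j + 1 : ℕ) : K) * (c * x ^ j) ^ p) = 0 := by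
        rw [Derivation.leibniz, deriv_pow_p]
        simp
      rw [e2, e3, iterate_mul_const δ e5, hwil]
      have e6 : ((c : K) * ((j + 1 : ℕ) * x ^ j)) ^ p = ((j + 1 : ℕ) : K) ^ p * (c * x ^ j) ^ p := by
        ring
      rw [e6, hj]
      ring

theorem iterate_sum' (δ : Derivation ℤ K K) (k : ℕ) {ι : Type} (s : Finset ι) (f : ι → K) :
    δ^[k] (∑ i ∈ s, f i) = ∑ i ∈ s, δ^[k] (f i) := by
  induction s using Finset.induction_on with
  | empty => simp [iterate_zero']
  | insert a s ha ih => rw [Finset.sum_insert ha, Finset.sum_insert ha, iterate_add', ih]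

theorem cartier_ind (δ : Derivation ℤ K K) (h0 : ∀ f, δ^[p] f = 0)
    (hT : ∀ f, δ^[p - 1] (f ^ (p - 1) * δ f) = -(δ f) ^ p) (m : ℕ) (μ : Fin (m + 1) → K)
    (h : ∑ i, μ i ^ (p ^ (m - (i : ℕ)) - 1) * δ (μ i) = 0) (i : Fin (m + 1)) : δ (μ i) = 0 := by
  have hp1 : p = (p - 1) + 1 := by have := hp.out.pos; omega
  induction m with
  | zero =>
    have : i = 0 := Fin.ext (by have := i.isLt; simp only [Fin.val_zero]; omega)
    subst this
    simpa using h
  | succ m ih =>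
    rw [Fin.sum_univ_castSucc] at h
    simp only [Fin.val_last, Nat.sub_self, pow_zero, one_mul, Fin.val_castSucc] at h
    have hterm : ∀ j : Fin (m + 1),
        δ^[p - 1] (μ j.castSucc ^ (p ^ (m + 1 - (j : ℕ)) - 1) * δ (μ j.castSucc)) =
        -(μ j.castSucc ^ (p ^ (m - (j : ℕ)) - 1) * δ (μ j.castSucc)) ^ p := by
      intro j
      have hj := j.isLt
      have e : p ^ (m + 1 - (j : ℕ)) - 1 = (p ^ (m - (j : ℕ)) - 1) * p + (p - 1) := by
        have e1 : m + 1 - (j : ℕ) = (m - j) + 1 := by omega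
        have h2 : 1 ≤ p ^ (m - (j : ℕ)) := Nat.pow_pos hp.out.pos
        have h3 : p ≤ p ^ (m - (j : ℕ)) * p := Nat.le_mul_of_pos_left _ h2
        have h4 := hp.out.pos
        rw [e1, pow_succ, Nat.sub_mul, one_mul]
        omega
      rw [e, pow_add, pow_mul, mul_assoc, iterate_mul_const δ (deriv_pow_p δ _), hT]
      ring
    have h2 := congrArg (δ^[p - 1]) h
    rw [iterate_add', iterate_zero', ← Function.iterate_succ_apply, Nat.succ_eq_add_one,
      ← hp1, h0, add_zero, iterate_sum', Finset.sum_congr rfl (fun j _ => hterm j),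
      Finset.sum_neg_distrib, neg_eq_zero, ← sum_pow_char] at h2
    have h3 := (pow_eq_zero_iff hp.out.ne_zero).mp h2
    have h4 := ih (fun j => μ j.castSucc) h3
    refine Fin.lastCases ?_ (fun j => h4 j) i
    rw [Finset.sum_eq_zero (fun j _ => by rw [h4 j, mul_zero]), zero_add] at h
    exact h

theorem cartier_pth (m : ℕ) (μ : Fin (m + 1) → K)
    (h : ∀ δ : K →+ K, (∀ a b, δ (a * b) = a * δ b + b * δ a) →
      ∑ i, μ i ^ (p ^ (m - (i : ℕ)) - 1) * δ (μ i) = 0) (i : Fin (m + 1)) : ∃ ν, μ i = ν ^ p := by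
  by_contra hne
  obtain ⟨δ, hx, h0, hT⟩ := exists_good_deriv (p := p) (fun y hy => hne ⟨y, hy⟩)
  have h1 := cartier_ind δ h0 hT m μ
    (h (δ : K →ₗ[ℤ] K).toAddMonoidHom (fun a b => δ.leibniz a b)) i
  rw [hx] at h1
  exact one_ne_zero h1

end Cartier

namespace DVField

section Key

variable {L : Type} [Field L] {D : DVField L} {K : Subfield L}

theorem psi_LGe (hK : D.IsCoeffField K) {a : L} {N : ℤ} (ha : D.Ge N a) : LGe N (psi hK a) :=
  fun _ hj => psi_coeff_of_ge hK ha hj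

theorem lead_spec (hK : D.IsCoeffField K) {a : L} {N : ℤ} (ha : D.Ge N a) :
    D.Ge (N + 1) (a - (psi hK a).coeff N * D.z ^ N) := by
  obtain ⟨u, hu, rfl⟩ := ha.exists_unit
  have h : D.Ge (N + 1) (D.z ^ N * u - D.rho K u * D.z ^ N) := by
    have := Ge.zpow_mul (N := N) (rho_spec hK hu)
    rwa [mul_sub, mul_comm _ (D.rho K u : L)] at this
  rw [psi_coeff_lead hK h]
  exact h

/-- The pushforward of differentials. -/
theorem exists_tau (hK : D.IsCoeffField K) (δ : K →+ K)
    (hδ : ∀ a b, δ (a * b) = a * δ b + b * δ a) (c : K) :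
    ∃ τ : Ω[L⁄ℤ] →+ LaurentSeries K,
      (∀ a, τ (KaehlerDifferential.D ℤ L a) = lauD δ c (psi hK a)) ∧
      ∀ a ω, τ (a • ω) = psi hK a * τ ω := by
  let δ' := lauD δ c
  exact exists_kaehler_push (psi hK) δ' (lauD_mul δ c hδ)

theorem tau_log (hK : D.IsCoeffField K) {δ : K →+ K} {c : K} {τ : Ω[L⁄ℤ] →+ LaurentSeries K}
    (h1 : ∀ a, τ (KaehlerDifferential.D ℤ L a) = lauD δ c (psi hK a))
    (h2 : ∀ a ω, τ (a • ω) = psi hK a * τ ω) {η : Ω[L⁄ℤ]} (hη : η ∈ D.OmegaOLog ℤ) :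
    LGe 0 (τ η) := by
  induction hη using AddSubgroup.closure_induction with
  | mem x hx =>
    rcases hx with ⟨a, b, ha, hb, rfl⟩ | ⟨a, ha, rfl⟩
    · rw [h2, h1]
      have ha' : D.Ge 0 a := by simpa [Ge] using ha
      have hb' : D.Ge 0 b := by simpa [Ge] using hb
      simpa using (psi_LGe hK ha').mul ((psi_LGe hK hb').lauD_ge δ c)
    · rw [h2, h2, h1]
      have ha' : D.Ge 0 a := by simpa [Ge] using ha
      have hz : D.Ge 1 D.z := by simpa using Ge.zpow (D := D) 1
      have hz' : D.Ge (-1) D.z⁻¹ := by simpa using Ge.zpow (D := D) (-1)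
      simpa using (psi_LGe hK ha').mul ((psi_LGe hK hz').mul ((psi_LGe hK hz).lauD_ge δ c))
  | zero => rw [map_zero]; exact LGe.zero
  | add x y _ _ hx hy => rw [map_add]; exact hx.add hy
  | neg x _ hx => rw [map_neg]; exact hx.neg

theorem tau_O (hK : D.IsCoeffField K) {c : K} {τ : Ω[L⁄ℤ] →+ LaurentSeries K}
    (h1 : ∀ a, τ (KaehlerDifferential.D ℤ L a) = lauD 0 c (psi hK a))
    (h2 : ∀ a ω, τ (a • ω) = psi hK a * τ ω) {η : Ω[L⁄ℤ]} (hη : η ∈ D.OmegaO ℤ) :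
    LGe 1 (τ η) := by
  induction hη using AddSubgroup.closure_induction with
  | mem x hx =>
    rcases hx with ⟨a, b, ha, hb, rfl⟩
    rw [h2, h1]
    have ha' : D.Ge 0 a := by simpa [Ge] using ha
    have hb' : D.Ge 0 b := by simpa [Ge] using hb
    have h3 : LGe 1 (lauD 0 c (psi hK b)) := by
      intro j hj
      by_cases hj0 : j = 0
      · subst hj0; simp [lauD_coeff]
      · exact ((psi_LGe hK hb').lauD_ge 0 c) j (by omega)
    simpa using (psi_LGe hK ha').mul h3
  | zero => rw [map_zero]; exact LGe.zero
  | add x y _ _ hx hy => rw [map_add]; exact hx.add hy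
  | neg x _ hx => rw [map_neg]; exact hx.neg

theorem tau_wFd (hK : D.IsCoeffField K) {δ : K →+ K} {c : K} {τ : Ω[L⁄ℤ] →+ LaurentSeries K}
    (h1 : ∀ a, τ (KaehlerDifferential.D ℤ L a) = lauD δ c (psi hK a))
    (h2 : ∀ a ω, τ (a • ω) = psi hK a * τ ω) {p n : ℕ} (x : TruncatedWittVector p n L) :
    τ (wFd p ℤ x) = ∑ i : Fin n, psi hK (x.coeff i) ^ (p ^ (n - 1 - (i : ℕ)) - 1) *
      lauD δ c (psi hK (x.coeff i)) := by
  rw [wFd, map_sum]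
  refine Finset.sum_congr rfl fun i _ => ?_
  rw [h2, h1, map_pow]

theorem pred_div {R e : ℕ} (hR : 1 ≤ R) : R / e = (R - 1) / e + if e ∣ R then 1 else 0 := by
  obtain ⟨R, rfl⟩ := Nat.exists_eq_add_of_le' hR
  simpa using Nat.succ_div (a := R) (b := e)

/-- Lemma A. -/
theorem lemmaA {p : ℕ} [hp : Fact p.Prime] [CharP L p] (hK : D.IsCoeffField K) {m s : ℕ}
    (hs : 1 ≤ s) {x : TruncatedWittVector p (m + 1) L} (hx : x ∈ D.filLog p s (m + 1))
    (h : wFd p ℤ x ∈ D.FilOmega ℤ p s) : x ∈ D.filKM p s (m + 1) := by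
  have hs0 : s ≠ 0 := by omega
  rw [mem_filKM_iff hs0]
  rw [mem_filLog_iff] at hx
  obtain ⟨τ, h1, h2⟩ := exists_tau hK (0 : K →+ K) (by simp) 1
  have hz : ∀ k : ℕ, LGe (-(k : ℤ)) (psi hK (D.z ^ k)⁻¹) := by
    intro k
    have := psi_LGe hK (Ge.zpow (D := D) (-(k : ℤ)))
    rwa [zpow_neg, zpow_natCast] at this
  have hτ : (τ (wFd p ℤ x)).coeff (-(s : ℤ)) = 0 := by
    rw [FilOmega] at h
    split_ifs at h with hps
    · obtain ⟨η, hη, e⟩ := h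
      rw [e, h2]
      exact ((hz s).mul (tau_O hK h1 h2 hη)) _ (by omega)
    · obtain ⟨η, hη, e⟩ := h
      rw [e, h2]
      exact ((hz (s - 1)).mul (tau_log hK h1 h2 hη)) _ (by omega)
  rw [tau_wFd hK h1 h2, HahnSeries.coeff_sum] at hτ
  have hL : ∀ i, LGe _ (psi hK (x.coeff i)) := fun i => psi_LGe hK (hx i)
  have hne : ∀ k, p ^ k ≠ 0 := fun k => pow_ne_zero _ hp.out.ne_zero
  intro i
  by_cases hd : p ^ (m + 1 - (i : ℕ)) ∣ s
  · have := hx i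
    simp only [kmB, hd, if_true]
    exact this
  by_cases hd' : p ^ (m + 1 - 1 - (i : ℕ)) ∣ s
  swap
  · have := hx i
    rw [pred_div hs, if_neg hd', add_zero] at this
    simp only [kmB, hd, if_false]
    exact this
  have hi := i.isLt
  -- only the `i`-th term contributes
  rw [Finset.sum_eq_single i] at hτ
  · have e : (-(s : ℤ)) = ((p ^ (m + 1 - 1 - (i : ℕ)) : ℕ) : ℤ) *
        (-((s / p ^ (m + 1 - 1 - (i : ℕ)) : ℕ) : ℤ)) := by
      rw [mul_neg]
      congr 1
      exact_mod_cast (Nat.mul_div_cancel' hd').symm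
    rw [e, (hL i).term_coeff _ _ (hne _), AddMonoidHom.zero_apply, zero_add, one_mul] at hτ
    have hq : (((-((s / p ^ (m + 1 - 1 - (i : ℕ)) : ℕ) : ℤ)) : ℤ) : K) ≠ 0 := by
      haveI : CharP K p := inferInstance
      rw [Ne, CharP.intCast_eq_zero_iff K p, dvd_neg, Int.natCast_dvd_natCast]
      intro h
      apply hd
      have e2 : m + 1 - (i : ℕ) = (m + 1 - 1 - i) + 1 := by omega
      rw [e2, pow_succ]
      exact (Nat.dvd_div_iff_mul_dvd hd').mp h
    have h0 : (psi hK (x.coeff i)).coeff (-((s / p ^ (m + 1 - 1 - (i : ℕ)) : ℕ) : ℤ)) = 0 := by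
      by_contra h0
      exact mul_ne_zero (pow_ne_zero _ h0) (mul_ne_zero hq h0) hτ
    have h3 := lead_spec hK (hx i)
    rw [h0] at h3
    simp only [ZeroMemClass.coe_zero, zero_mul, sub_zero] at h3
    refine h3.mono ?_
    have h4 := pred_div (e := p ^ (m + 1 - 1 - (i : ℕ))) hs
    rw [if_pos hd'] at h4
    simp only [kmB, hd, if_false]
    omega
  · intro k _ hki
    have hk := k.isLt
    by_cases hdk : p ^ (m + 1 - 1 - (k : ℕ)) ∣ s
    · have e : (-(s : ℤ)) = ((p ^ (m + 1 - 1 - (k : ℕ)) : ℕ) : ℤ) *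
          (-((s / p ^ (m + 1 - 1 - (k : ℕ)) : ℕ) : ℤ)) := by
        rw [mul_neg]
        congr 1
        exact_mod_cast (Nat.mul_div_cancel' hdk).symm
      rw [e, (hL k).term_coeff _ _ (hne _), AddMonoidHom.zero_apply, zero_add, one_mul]
      have hq : (((-((s / p ^ (m + 1 - 1 - (k : ℕ)) : ℕ) : ℤ)) : ℤ) : K) = 0 := by
        haveI : CharP K p := inferInstance
        rw [CharP.intCast_eq_zero_iff K p, dvd_neg, Int.natCast_dvd_natCast,
          Nat.dvd_div_iff_mul_dvd hdk, ← pow_succ]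
        have hki' : (k : ℕ) ≠ i := fun h => hki (Fin.ext h)
        rcases lt_or_gt_of_ne hki' with hlt | hgt
        · exfalso
          apply hd
          exact (pow_dvd_pow p (by omega)).trans hdk
        · exact (pow_dvd_pow p (by omega)).trans hd'
      rw [hq, zero_mul, mul_zero]
    · refine ((hL k).term _ _ (hne _)) _ ?_
      have h5 : p ^ (m + 1 - 1 - (k : ℕ)) * (s / p ^ (m + 1 - 1 - (k : ℕ))) < s :=
        lt_of_le_of_ne (Nat.mul_div_le _ _) fun h => hdk ⟨_, h.symm⟩
      rw [mul_neg, neg_lt_neg_iff]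
      exact_mod_cast h5
  · intro h; exact absurd (Finset.mem_univ i) h

theorem gain_div {p : ℕ} [hp : Fact p.Prime] {m R k : ℕ} (hk : k ≤ m) (hR : 1 ≤ R) :
    ((R : ℤ) * (p ^ k : ℕ) - 1) / (p ^ m : ℕ) = (((R - 1) / p ^ (m - k) : ℕ) : ℤ) := by
  have hpos : 1 ≤ R * p ^ k := Nat.mul_pos hR (pow_pos hp.out.pos _)
  have e0 : ((R : ℤ) * (p ^ k : ℕ) - 1) = ((R * p ^ k - 1 : ℕ) : ℤ) := by
    rw [Nat.cast_sub hpos]; push_cast; ring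
  have e : p ^ m = p ^ k * p ^ (m - k) := by rw [← pow_add]; congr 1; omega
  rw [e0, ← Int.natCast_div, e, ← Nat.div_div_eq_div_mul]
  congr 2
  have h1 := pow_pos hp.out.pos k
  apply Nat.div_eq_of_lt_le
  · have : (R - 1) * p ^ k = R * p ^ k - p ^ k := by rw [Nat.sub_mul, one_mul]
    omega
  · rw [Nat.sub_add_cancel hR]; omega

/-- Lemma B. -/
theorem lemmaB {p : ℕ} [hp : Fact p.Prime] [CharP L p] (hK : D.IsCoeffField K) {m r : ℕ}
    (hr : 2 ≤ r) (hpr : p ∣ r) {x : TruncatedWittVector p (m + 1) L}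
    (hx : x ∈ D.filKM p r (m + 1))
    (h1 : x.coeff (0 : Fin (m + 1)) ^ p ^ m ∈ D.filWOne p (r - 1))
    (h2 : wFd p ℤ x ∈ D.FilOmega ℤ p (r - 1)) :
    ∃ γ ∈ D.filKM p r m, ∃ y ∈ D.filLog p (r - 1) (m + 1), x = y + wP γ := by
  have hr0 : r ≠ 0 := by omega
  have hr1 : 1 ≤ r := by omega
  have hpr' : ¬ p ∣ r - 1 := by
    intro h
    have h3 := (Nat.dvd_sub hpr h)
    have h4 : r - (r - 1) = 1 := by omega
    rw [h4] at h3
    exact hp.out.one_lt.ne' (Nat.dvd_one.mp h3)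
  rw [mem_filKM_iff hr0] at hx
  have hne : ∀ k, p ^ k ≠ 0 := fun k => pow_ne_zero _ hp.out.ne_zero
  let P : Fin (m + 1) → Prop := fun i => p ^ (m + 1 - (i : ℕ)) ∣ r
  have hPe : ∀ i, P i → p ^ (m - (i : ℕ)) ∣ r := fun i hi =>
    (pow_dvd_pow p (by omega)).trans hi
  have hx1 : ∀ i, P i → D.Ge (-((r / p ^ (m - (i : ℕ)) : ℕ) : ℤ)) (x.coeff i) := by
    intro i hi
    have := hx i
    simp only [kmB, P] at this hi
    rw [if_pos hi] at this
    exact this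
  have hx2 : ∀ i, ¬ P i → D.Ge (-(((r - 1) / p ^ (m - (i : ℕ)) : ℕ) : ℤ)) (x.coeff i) := by
    intro i hi
    have := hx i
    simp only [kmB, P] at this hi
    rw [if_neg hi] at this
    exact this
  let μ : Fin (m + 1) → K := fun i =>
    if P i then (psi hK (x.coeff i)).coeff (-((r / p ^ (m - (i : ℕ)) : ℕ) : ℤ)) else 0
  have hneg : ∀ i, P i → (-(r : ℤ)) = ((p ^ (m - (i : ℕ)) : ℕ) : ℤ) *
        (-((r / p ^ (m - (i : ℕ)) : ℕ) : ℤ)) := by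
    intro i hi
    rw [mul_neg]
    congr 1
    exact_mod_cast (Nat.mul_div_cancel' (hPe i hi)).symm
  -- all `μ i` are `p`-th powers
  have hpth : ∀ i, ∃ ν : K, μ i = ν ^ p := by
    haveI : CharP K p := inferInstance
    refine cartier_pth (p := p) m μ ?_
    intro δ hδ
    obtain ⟨τ, t1, t2⟩ := exists_tau hK δ hδ 0
    have hτ : (τ (wFd p ℤ x)).coeff (-(r : ℤ)) = 0 := by
      rw [FilOmega, if_neg hpr'] at h2
      obtain ⟨η, hη, e⟩ := h2
      rw [e, t2]
      have hz := psi_LGe hK (Ge.zpow (D := D) (-((r - 1 - 1 : ℕ) : ℤ)))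
      rw [zpow_neg, zpow_natCast] at hz
      exact (hz.mul (tau_log hK t1 t2 hη)) _ (by omega)
    rw [tau_wFd hK t1 t2, HahnSeries.coeff_sum] at hτ
    rw [← hτ]
    refine Finset.sum_congr rfl fun i _ => ?_
    by_cases hi : P i
    · have := (psi_LGe hK (hx1 i hi)).term_coeff δ 0 (hne (m - i))
      rw [← hneg i hi] at this
      simp only [Nat.add_sub_cancel]
      rw [this]
      simp [μ, hi]
    · have := (psi_LGe hK (hx2 i hi)).term δ 0 (hne (m - i)) (-(r : ℤ)) ?_
      · simp only [Nat.add_sub_cancel]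
        rw [this]
        simp [μ, hi]
      · rw [mul_neg, neg_lt_neg_iff]
        have : p ^ (m - (i : ℕ)) * ((r - 1) / p ^ (m - (i : ℕ))) < r :=
          lt_of_le_of_lt (Nat.mul_div_le _ _) (by omega)
        exact_mod_cast this
  choose ν hν using hpth
  have hμ0 : μ 0 = 0 := by
    by_cases hi : P 0
    · have h3 := (psi_LGe hK (hx1 0 hi)).coeff_pow (p ^ (m - ((0 : Fin (m + 1)) : ℕ)))
      rw [← hneg 0 hi, ← map_pow] at h3
      rw [filWOne, if_neg hpr'] at h1
      have h4 : D.Ge (-(((r - 1 : ℕ) : ℤ) - 1)) (x.coeff 0 ^ p ^ m) := h1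
      rw [psi_coeff_of_ge hK (by simpa using h4) (by omega)] at h3
      have := (pow_eq_zero_iff (hne _)).mp h3.symm
      simp only [μ, if_pos hi]
      exact this
    · simp only [μ, if_neg hi]
  let β : TruncatedWittVector p (m + 1) L := TruncatedWittVector.mk p fun i =>
    (μ i : L) * D.z ^ (-((r / p ^ (m - (i : ℕ)) : ℕ) : ℤ))
  let γ : TruncatedWittVector p m L := TruncatedWittVector.mk p fun i =>
    (ν i.succ : L) * D.z ^ (-((r / p ^ (m - (i : ℕ)) : ℕ) : ℤ))
  have hβγ : β = wP γ := by
    ext i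
    refine Fin.cases ?_ (fun i => ?_) i
    · rw [wP_coeff_zero, TruncatedWittVector.coeff_mk, hμ0]; simp
    · rw [wP_coeff_succ, TruncatedWittVector.coeff_mk, TruncatedWittVector.coeff_mk, hν i.succ,
        mul_pow, ← zpow_natCast (D.z ^ _) p, ← zpow_mul,
        show ((ν i.succ ^ p : K) : L) = (ν i.succ : L) ^ p from rfl]
      by_cases hi : P i.succ
      · have hi2 := i.isLt
        have h5 : p ^ (m - (i : ℕ)) ∣ r := by
          have e : m + 1 - ((i.succ : Fin (m + 1)) : ℕ) = m - i := by rw [Fin.val_succ]; omega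
          simp only [P, e] at hi
          exact hi
        have h6 : r / p ^ (m - (i : ℕ)) * p = r / p ^ (m - ((i.succ : Fin (m + 1)) : ℕ)) := by
          obtain ⟨q, hq⟩ := h5
          have e : m - (i : ℕ) = (m - ((i.succ : Fin (m + 1)) : ℕ)) + 1 := by
            rw [Fin.val_succ]; omega
          rw [e] at hq ⊢
          rw [hq, Nat.mul_div_cancel_left _ (Nat.pos_of_ne_zero (hne _)), pow_succ, mul_assoc,
            Nat.mul_div_cancel_left _ (Nat.pos_of_ne_zero (hne _)), mul_comm]
        rw [← h6]
        push_cast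
        congr 2
        ring
      · have h7 : μ i.succ = 0 := by simp only [μ, if_neg hi]
        rw [hν] at h7
        have h8 := (pow_eq_zero_iff hp.out.ne_zero).mp h7
        rw [h8]
        simp [hp.out.ne_zero]
  refine ⟨γ, ?_, x - β, ?_, by rw [← hβγ, sub_add_cancel]⟩
  · rw [mem_filKM_iff hr0]
    intro i
    rw [TruncatedWittVector.coeff_mk]
    have hi := i.isLt
    refine ((coe_ge hK (ν i.succ)).mul (Ge.zpow _)).mono ?_
    have h5 := le_kmB (p := p) r m i
    have h6 : r / p ^ (m - (i : ℕ)) ≤ (r - 1) / p ^ (m - 1 - (i : ℕ)) := by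
      have e : m - (i : ℕ) = (m - 1 - i) + 1 := by omega
      rw [e, pow_succ', ← Nat.div_div_eq_div_mul]
      refine Nat.div_le_div_right ?_
      have := Nat.div_lt_self (by omega : 0 < r) hp.out.one_lt
      omega
    omega
  · rw [mem_filLog_iff]
    intro i
    have e : x - β = WittVector.truncate (m + 1) (x.out - β.out) := by
      rw [map_sub]
      congr 1
      · ext i; rw [WittVector.coeff_truncate, TruncatedWittVector.coeff_out]
      · ext i; rw [WittVector.coeff_truncate, TruncatedWittVector.coeff_out]
    have hi := i.isLt
    rw [e, WittVector.coeff_truncate]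
    have hout : ∀ (y : TruncatedWittVector p (m + 1) L) (k : ℕ) (hk : k < m + 1),
        y.out.coeff k = y.coeff ⟨k, hk⟩ := fun y k hk => TruncatedWittVector.coeff_out y ⟨k, hk⟩
    have hout' : ∀ (y : TruncatedWittVector p (m + 1) L) (k : ℕ), ¬ k < m + 1 →
        y.out.coeff k = 0 := fun y k hk => by
      exact dif_neg hk
    have key := witt_gain' (D := D) (p := p) (p ^ m) r (pow_pos hp.out.pos _) x.out β.out
      ?_ ?_ ?_ i
    · rw [gain_div (by omega) hr1] at key
      exact key
    · intro k
      by_cases hk : k < m + 1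
      · have e2 := div_cast (p := p) (R := r) hk
        simp only [Nat.add_sub_cancel] at e2
        rw [e2, hout _ _ hk]
        refine (hx ⟨k, hk⟩).mono ?_
        have := kmB_le (p := p) r (m + 1) k
        simp only [Nat.add_sub_cancel] at this ⊢
        omega
      · rw [hout' _ _ hk]; exact Ge.zero _
    · intro k
      by_cases hk : k < m + 1
      · have e2 := div_cast (p := p) (R := r) hk
        simp only [Nat.add_sub_cancel] at e2
        rw [e2, hout _ _ hk, TruncatedWittVector.coeff_mk]
        exact ((coe_ge hK (μ ⟨k, hk⟩)).mul (Ge.zpow _)).mono (by simp)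
      · rw [hout' _ _ hk]; exact Ge.zero _
    · intro k
      by_cases hk : k < m + 1
      · rw [hout _ _ hk, hout _ _ hk, TruncatedWittVector.coeff_mk, gain_div (by omega) hr1]
        by_cases hi : P ⟨k, hk⟩
        · have h5 := lead_spec hK (hx1 _ hi)
          simp only [μ, if_pos hi]
          refine h5.mono ?_
          have h6 := pred_div (e := p ^ (m - k)) hr1
          rw [if_pos (hPe _ hi)] at h6
          simp only
          omega
        · have h7 : μ ⟨k, hk⟩ = 0 := by simp only [μ, if_neg hi]
          rw [h7]
          simpa using hx2 _ hi
      · rw [hout' _ _ hk, hout' _ _ hk, sub_zero]; exact Ge.zero _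

end Key

end DVField

/-- (Weight-zero case of the key injectivity lemma.)  Assume `O` is henselian
and admits a coefficient field `K ⊆ O`.  Let `n = m+1 ≥ 1` and `r ≥ 2`.  If
`a ∈ Fil^p_r Wₙ(L)` satisfies `F^{n-1}(a) = a₀^{p^{n-1}} ∈ filW₁_{r-1}` and
`F^{n-1}d(a) ∈ FilΩ_{r-1}`, then `a ∈ Fil^p_{r-1} Wₙ(L) + p̲(Fil^p_r W_{n-1}(L))`. -/
theorem statement9 (p : ℕ) [Fact p.Prime] (L : Type) [Field L] [CharP L p]
    (D : DVField L) (hhens : D.IsHenselian) (K : Subfield L) (hK : D.IsCoeffField K)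
    (m r : ℕ) (hr : 2 ≤ r)
    (a : TruncatedWittVector p (m + 1) L) (ha : a ∈ D.FilP p r (m + 1))
    (h1 : a.coeff (0 : Fin (m + 1)) ^ p ^ m ∈ D.filWOne p (r - 1))
    (h2 : wFd p ℤ a ∈ D.FilOmega ℤ p (r - 1)) :
    ∃ b ∈ D.FilP p (r - 1) (m + 1), ∃ c ∈ D.FilP p r m, a = b + wP c := by
  classical
  have hr0 : r ≠ 0 := by omega
  obtain ⟨f0, hf0, c0, hc0, rfl⟩ := DVField.FilP_decomp hr0 ha
  have hco : ∀ (y : TruncatedWittVector p (m + 1) L) (c : TruncatedWittVector p m L),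
      (y + wP c).coeff (0 : Fin (m + 1)) = y.coeff (0 : Fin (m + 1)) := by
    intro y c
    have h := wP_coeff_zero c
    obtain ⟨y, rfl⟩ := WittVector.truncate_surjective p (m + 1) L y
    obtain ⟨w, hw⟩ := WittVector.truncate_surjective p (m + 1) L (wP c)
    rw [← hw] at h ⊢
    rw [← map_add, WittVector.coeff_truncate, WittVector.coeff_truncate]
    rw [WittVector.coeff_truncate] at h
    simp only [Fin.val_zero] at h ⊢
    rw [WittVector.add_coeff_zero, h, add_zero]
  rw [hco] at h1
  rw [wFd_add, wFd_wP, add_zero] at h2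
  by_cases hpr : p ∣ r
  · obtain ⟨γ, hγ, y, hy, rfl⟩ := DVField.lemmaB hK hr hpr hf0 h1 h2
    rw [wFd_add, wFd_wP, add_zero] at h2
    refine ⟨y, DVField.filKM_sub_FilP (by omega) (DVField.lemmaA hK (by omega) hy h2),
      γ + c0, DVField.FilP_add hr0 (DVField.filKM_sub_FilP hr0 hγ) hc0, ?_⟩
    rw [wP_add, add_assoc]
  · have hlog : f0 ∈ D.filLog p (r - 1) (m + 1) := by
      rw [DVField.mem_filKM_iff hr0] at hf0
      rw [DVField.mem_filLog_iff]
      intro i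
      have h3 := hf0 i
      have hi := i.isLt
      have hnd : ¬ p ^ (m + 1 - (i : ℕ)) ∣ r := fun h =>
        hpr ((dvd_pow_self p (by omega)).trans h)
      simp only [DVField.kmB, if_neg hnd] at h3
      exact h3
    exact ⟨f0, DVField.filKM_sub_FilP (by omega) (DVField.lemmaA hK (by omega) hlog h2),
      c0, hc0, rfl⟩
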